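/- Let α be a smooth Hermitian metric and χ a smooth real (1,1)-form on the closed unit ball of ℂ^n. There exists δ₀ > 0 depending only on χ and α such that the following gradient estimate holds: for Ω = B(0, δ) with 0 < δ ≤ δ₀, if χ ≥ α on the closure of Ω, 0 < h is smooth on the closure of Ω, and u is a smooth admissible solution of S_m(λ(A(u))) = h^m in Ω with u = 0 on ∂Ω, then sup_Ω |∇u| ≤ C, where C depends only on n, m, sup_Ω |u|, sup_{∂Ω} |∇u|, h, χ and α. -/

import Mathlib

open scoped BigOperators ContDiff ComplexOrder
open Metric

noncomputable section

/-- `ℂ^n` with the Euclidean metric. -/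
abbrev Cn (n : ℕ) := EuclideanSpace ℂ (Fin n)

/-- The `k`-th elementary symmetric polynomial `S_k`. -/
def esymm {n : ℕ} (k : ℕ) (lam : Fin n → ℝ) : ℝ :=
  ∑ s ∈ Finset.univ.powersetCard k, ∏ i ∈ s, lam i

/-- The cone `Γ_m = {λ : S_1(λ) > 0, …, S_m(λ) > 0}`. -/
def GammaCone (n m : ℕ) : Set (Fin n → ℝ) :=
  {lam | ∀ k, 1 ≤ k → k ≤ m → 0 < esymm k lam}

/-- `lam` is the tuple of eigenvalues of `a⁻¹ g` (i.e. of `g` with respect to the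
Hermitian metric `a`): the roots of `det (g - t a) = 0`, counted with multiplicity. -/
def IsEigenvalues {n : ℕ} (a g : Matrix (Fin n) (Fin n) ℂ) (lam : Fin n → ℝ) : Prop :=
  ∀ t : ℝ, (g - (t : ℂ) • a).det = a.det * ∏ i, ((lam i : ℂ) - (t : ℂ))

/-- Wirtinger derivative `∂f/∂z_i` relative to a set `s`. -/
def wderOn {n : ℕ} (s : Set (Cn n)) (i : Fin n) (f : Cn n → ℂ) (z : Cn n) : ℂ :=
  (fderivWithin ℝ f s z (EuclideanSpace.single i 1)
    - Complex.I * fderivWithin ℝ f s z (EuclideanSpace.single i Complex.I)) / 2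

/-- Conjugate Wirtinger derivative `∂f/∂z̄_i` relative to a set `s`. -/
def wderBarOn {n : ℕ} (s : Set (Cn n)) (i : Fin n) (f : Cn n → ℂ) (z : Cn n) : ℂ :=
  (fderivWithin ℝ f s z (EuclideanSpace.single i 1)
    + Complex.I * fderivWithin ℝ f s z (EuclideanSpace.single i Complex.I)) / 2

/-- Complex Hessian `∂²u/∂z_i ∂z̄_j` of a real-valued function, relative to a set `s`. -/
def cHessOn {n : ℕ} (s : Set (Cn n)) (u : Cn n → ℝ) (i j : Fin n) (z : Cn n) : ℂ :=
  wderOn s i (wderBarOn s j fun w => (u w : ℂ)) z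

/-- The matrix `g_{i j̄} = χ_{i j̄} + ∂²u/∂z_i ∂z̄_j`. -/
def gMatOn {n : ℕ} (s : Set (Cn n)) (χ : Cn n → Matrix (Fin n) (Fin n) ℂ) (u : Cn n → ℝ)
    (z : Cn n) : Matrix (Fin n) (Fin n) ℂ :=
  Matrix.of fun i j => χ z i j + cHessOn s u i j z

/-- `α` is a smooth Hermitian metric on `S`. -/
def IsHermitianMetricOn {n : ℕ} (α : Cn n → Matrix (Fin n) (Fin n) ℂ) (S : Set (Cn n)) : Prop :=
  (∀ i j, ContDiffOn ℝ ∞ (fun z => α z i j) S) ∧ ∀ z ∈ S, (α z).PosDef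

/-- `χ` is a smooth real `(1,1)`-form on `S`. -/
def IsRealFormOn {n : ℕ} (χ : Cn n → Matrix (Fin n) (Fin n) ℂ) (S : Set (Cn n)) : Prop :=
  (∀ i j, ContDiffOn ℝ ∞ (fun z => χ z i j) S) ∧ ∀ z ∈ S, (χ z).IsHermitian

/-- `u` is admissible and solves `S_m(λ(A(u))) = f` on `S`; derivatives are taken
relative to the set `s`. -/
def IsAdmissibleSolutionOn {n : ℕ} (m : ℕ) (α χ : Cn n → Matrix (Fin n) (Fin n) ℂ)
    (s : Set (Cn n)) (u f : Cn n → ℝ) (S : Set (Cn n)) : Prop :=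
  ∀ z ∈ S, ∃ lam : Fin n → ℝ, IsEigenvalues (α z) (gMatOn s χ u z) lam ∧
    lam ∈ GammaCone n m ∧ esymm m lam = f z

/-- The `k`-th elementary symmetric polynomial in the variables indexed by `s`. -/
def esymmOn {ι : Type*} (s : Finset ι) (k : ℕ) (f : ι → ℝ) : ℝ :=
  ∑ t ∈ s.powersetCard k, ∏ i ∈ t, f i

lemma esymmOn_zero {ι : Type*} (s : Finset ι) (f : ι → ℝ) : esymmOn s 0 f = 1 := by
  simp [esymmOn]

lemma esymmOn_insert {ι : Type*} [DecidableEq ι] {s : Finset ι} {i : ι} (hi : i ∉ s) (k : ℕ)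
    (f : ι → ℝ) :
    esymmOn (insert i s) (k + 1) f = esymmOn s (k + 1) f + f i * esymmOn s k f := by
  unfold esymmOn
  rw [Finset.powersetCard_succ_insert hi, Finset.sum_union, Finset.sum_image, Finset.mul_sum]
  · congr 1
    refine Finset.sum_congr rfl fun t ht => ?_
    rw [Finset.prod_insert fun h => hi ((Finset.mem_powersetCard.1 ht).1 h)]
  · intro t ht t' ht' h
    have h1 : i ∉ t := fun h => hi ((Finset.mem_powersetCard.1 ht).1 h)
    have h2 : i ∉ t' := fun h => hi ((Finset.mem_powersetCard.1 ht').1 h)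
    rw [← Finset.erase_insert h1, ← Finset.erase_insert h2]
    exact congrArg (fun x => Finset.erase x i) h
  · rw [Finset.disjoint_left]
    intro t ht ht'
    obtain ⟨t', -, rfl⟩ := Finset.mem_image.1 ht'
    exact hi ((Finset.mem_powersetCard.1 ht).1 (Finset.mem_insert_self _ _))

lemma esymm_eq_erase {n : ℕ} (i : Fin n) (k : ℕ) (f : Fin n → ℝ) :
    esymm (k + 1) f = esymmOn (Finset.univ.erase i) (k + 1) f
      + f i * esymmOn (Finset.univ.erase i) k f := by
  rw [← esymmOn_insert (Finset.notMem_erase i _), Finset.insert_erase (Finset.mem_univ i)]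
  rfl

open Polynomial in
lemma coeff_prod_one_add_C_mul_X {ι : Type*} (s : Finset ι) (k : ℕ) (f : ι → ℝ) :
    (∏ i ∈ s, (1 + C (f i) * X)).coeff k = esymmOn s k f := by
  classical
  induction s using Finset.induction_on generalizing k with
  | empty =>
    cases k with
    | zero => simp [esymmOn]
    | succ k => simp [esymmOn, coeff_one,
        Finset.powersetCard_eq_empty.2 (show (∅ : Finset ι).card < k + 1 by simp)]
  | insert i s hi ih =>
    rw [Finset.prod_insert hi, add_mul, one_mul, coeff_add, ih, mul_assoc, coeff_C_mul]
    cases k with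
    | zero => simp [esymmOn_zero]
    | succ k => rw [coeff_X_mul, ih, esymmOn_insert hi]

open Polynomial in
lemma Polynomial.Splits.derivative_real {p : ℝ[X]} (hp : p.Splits) : p.derivative.Splits := by
  rw [splits_iff_card_roots] at hp ⊢
  have h1 := card_roots_le_derivative p
  have h2 := natDegree_derivative_le p
  have h3 := card_roots' p.derivative
  omega

open Polynomial in
lemma Polynomial.Splits.eval_mul_eval_derivative_two_le {p : ℝ[X]} (hp : p.Splits) (x : ℝ) :
    p.eval x * p.derivative.derivative.eval x ≤ p.derivative.eval x ^ 2 := by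
  rw [splits_iff_exists_multiset] at hp
  obtain ⟨s, hs⟩ := hp
  rw [hs]
  clear hs
  induction s using Multiset.induction_on with
  | empty => simp
  | cons a s ih =>
    rw [Multiset.map_cons, Multiset.prod_cons, mul_left_comm]
    set q := C p.leadingCoeff * (Multiset.map (fun a => X - C a) s).prod
    simp only [derivative_mul, derivative_sub, derivative_X, derivative_C, sub_zero, one_mul,
      derivative_add, eval_add, eval_mul, eval_sub, eval_X, eval_C]
    nlinarith [mul_le_mul_of_nonneg_left ih (sq_nonneg (x - a)), sq_nonneg (eval x q)]

open Polynomial in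
/-- Newton's inequality, in the weak form with constant one. -/
lemma esymmOn_newton {ι : Type*} (s : Finset ι) (k : ℕ) (f : ι → ℝ) :
    esymmOn s k f * esymmOn s (k + 2) f ≤ esymmOn s (k + 1) f ^ 2 := by
  set p : ℝ[X] := ∏ i ∈ s, (1 + C (f i) * X) with hpdef
  have hp : p.Splits := by
    refine Splits.prod fun i _ => ?_
    refine Splits.of_natDegree_le_one ?_
    compute_degree
  have hk : ∀ k, (derivative^[k] p).Splits := fun k => by
    induction k with
    | zero => exact hp
    | succ k ih => rw [Function.iterate_succ_apply']; exact ih.derivative_real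
  have h := (hk k).eval_mul_eval_derivative_two_le 0
  rw [← Function.iterate_succ_apply' derivative, ← Function.iterate_succ_apply' derivative] at h
  simp only [← coeff_zero_eq_eval_zero, coeff_iterate_derivative, zero_add,
    Nat.descFactorial_self, nsmul_eq_mul, hpdef, coeff_prod_one_add_C_mul_X] at h
  by_cases hneg : esymmOn s k f * esymmOn s (k + 2) f ≤ 0
  · exact hneg.trans (sq_nonneg _)
  push Not at hneg
  have hf : (0 : ℝ) < (k.factorial : ℝ) := by positivity
  simp only [Nat.succ_eq_add_one, Nat.factorial_succ, Nat.cast_mul, Nat.cast_add, Nat.cast_one] at h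
  set a := esymmOn s k f
  set b := esymmOn s (k + 1) f
  set c := esymmOn s (k + 2) f
  have h' : ((k.factorial : ℝ) ^ 2 * (k + 1)) * ((k + 2) * (a * c))
      ≤ ((k.factorial : ℝ) ^ 2 * (k + 1)) * ((k + 1) * b ^ 2) := by
    ring_nf at h ⊢
    linarith
  have h2 := le_of_mul_le_mul_left h' (by positivity)
  have hk0 : (0 : ℝ) < (k : ℝ) + 1 := by positivity
  have : ((k : ℝ) + 1) * (a * c) ≤ ((k : ℝ) + 1) * b ^ 2 := by nlinarith
  exact le_of_mul_le_mul_left this hk0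

/-- Deleting a variable maps `Γ_m` into `Γ_{m-1}`. -/
lemma esymmOn_erase_pos {n m : ℕ} {lam : Fin n → ℝ} (h : lam ∈ GammaCone n m) (i : Fin n) :
    ∀ k, k < m → 0 < esymmOn (Finset.univ.erase i) k lam := by
  intro k
  induction k with
  | zero => intro _; rw [esymmOn_zero]; norm_num
  | succ k ih =>
    intro hk
    have h0 := ih (by omega)
    have h1 := h (k + 1) (by omega) (by omega)
    have h2 := h (k + 2) (by omega) (by omega)
    rw [esymm_eq_erase i] at h1 h2
    have hN := esymmOn_newton (Finset.univ.erase i) k lam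
    simp only [show k + 1 + 1 = k + 2 from rfl] at h2
    set a := esymmOn (Finset.univ.erase i) k lam
    set b := esymmOn (Finset.univ.erase i) (k + 1) lam
    set c := esymmOn (Finset.univ.erase i) (k + 2) lam
    by_contra hb
    push Not at hb
    have hl : 0 < lam i := by
      by_contra hl
      push Not at hl
      nlinarith
    nlinarith

lemma esymm_pow_le_esymm_pow {n m : ℕ} {lam : Fin n → ℝ} (h : lam ∈ GammaCone n (m + 1)) :
    esymm (m + 1) lam ^ m ≤ esymm m lam ^ (m + 1) := by
  have key : ∀ k, k ≤ m → 0 < esymm k lam ∧ 0 < esymm (k + 1) lam ∧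
      esymm (k + 1) lam ^ k ≤ esymm k lam ^ (k + 1) := by
    intro k
    induction k with
    | zero =>
      intro _
      have : esymm 0 lam = 1 := esymmOn_zero _ _
      refine ⟨by rw [this]; norm_num, h _ (by omega) (by omega), by rw [this]; simp⟩
    | succ k ih =>
      intro hk
      obtain ⟨h0, h1, h2⟩ := ih (by omega)
      have h3 := h (k + 2) (by omega) (by omega)
      refine ⟨h1, h3, ?_⟩
      have hN : esymm k lam * esymm (k + 2) lam ≤ esymm (k + 1) lam ^ 2 :=
        esymmOn_newton Finset.univ k lam
      simp only [show k + 1 + 1 = k + 2 from rfl]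
      set a := esymm k lam
      set b := esymm (k + 1) lam
      set c := esymm (k + 2) lam
      have h4 : (a * c) ^ (k + 1) ≤ (b ^ 2) ^ (k + 1) := pow_le_pow_left₀ (by positivity) hN _
      have h5 : b ^ k * c ^ (k + 1) ≤ b ^ k * b ^ (k + 2) :=
        calc b ^ k * c ^ (k + 1) ≤ a ^ (k + 1) * c ^ (k + 1) := by gcongr
          _ = (a * c) ^ (k + 1) := by rw [mul_pow]
          _ ≤ (b ^ 2) ^ (k + 1) := h4
          _ = b ^ k * b ^ (k + 2) := by rw [← pow_mul, ← pow_add]; congr 1; omega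
      exact le_of_mul_le_mul_left h5 (by positivity)
  exact (key m le_rfl).2.2

lemma sum_esymmOn_erase {n : ℕ} (k : ℕ) (lam : Fin n → ℝ) :
    ∑ i, esymmOn (Finset.univ.erase i) k lam = ((n - k : ℕ) : ℝ) * esymm k lam := by
  have h1 : ∀ i : Fin n, (Finset.univ.erase i).powersetCard k
      = (Finset.univ.powersetCard k).filter fun t => i ∉ t := by
    intro i; ext t
    simp only [Finset.mem_powersetCard, Finset.mem_filter, Finset.subset_univ, true_and,
      Finset.subset_erase]
    tauto
  unfold esymmOn esymm
  simp only [h1, Finset.sum_filter]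
  rw [Finset.sum_comm, Finset.mul_sum]
  refine Finset.sum_congr rfl fun t ht => ?_
  rw [← Finset.sum_filter, Finset.sum_const, nsmul_eq_mul]
  have : (Finset.univ.filter fun i => i ∉ t) = tᶜ := by ext; simp
  rw [this, Finset.card_compl, (Finset.mem_powersetCard.1 ht).2, Fintype.card_fin]

/-- Lower bound for the trace of the linearised operator. -/
lemma le_sum_esymmOn_erase {n m : ℕ} (hmn : m + 1 ≤ n) {lam : Fin n → ℝ}
    (h : lam ∈ GammaCone n (m + 1)) {b : ℝ} (hb : 0 ≤ b)
    (hbm : b ^ (m + 1) ≤ esymm (m + 1) lam) :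
    b ^ m ≤ ∑ i, esymmOn (Finset.univ.erase i) m lam := by
  have h0 : 0 < esymm m lam := by
    rcases Nat.eq_zero_or_pos m with rfl | hm
    · rw [show esymm 0 lam = 1 from esymmOn_zero _ _]; norm_num
    · exact h m hm (by omega)
  have h1 : (b ^ m) ^ (m + 1) ≤ esymm m lam ^ (m + 1) := by
    refine le_trans ?_ (esymm_pow_le_esymm_pow h)
    rw [← pow_mul, mul_comm, pow_mul]
    exact pow_le_pow_left₀ (by positivity) hbm _
  have h2 : b ^ m ≤ esymm m lam := le_of_pow_le_pow_left₀ (by omega) h0.le h1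
  rw [sum_esymmOn_erase]
  have : (1 : ℝ) ≤ ((n - m : ℕ) : ℝ) := by exact_mod_cast (by omega : 1 ≤ n - m)
  nlinarith

/-- A Hermitian form can be diagonalised with respect to a positive definite one. -/
lemma exists_simultaneous_diagonalization {n : ℕ} {a g : Matrix (Fin n) (Fin n) ℂ}
    (ha : a.PosDef) (hg : g.IsHermitian) :
    ∃ (P : Matrix (Fin n) (Fin n) ℂ) (μ : Fin n → ℝ), P.conjTranspose * a * P = 1 ∧
      P.conjTranspose * g * P = Matrix.diagonal fun i => (μ i : ℂ) := by
  open scoped MatrixOrder in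
  obtain ⟨B, hB⟩ := CStarAlgebra.nonneg_iff_eq_star_mul_self.mp ha.posSemidef.nonneg
  rw [Matrix.star_eq_conjTranspose] at hB
  have hdet : IsUnit B.det := by
    have h := (Matrix.isUnit_iff_isUnit_det _).1 ha.isUnit
    rw [hB, Matrix.det_mul] at h
    exact isUnit_of_mul_isUnit_right h
  have hg' : (B⁻¹.conjTranspose * g * B⁻¹).IsHermitian :=
    Matrix.isHermitian_conjTranspose_mul_mul _ hg
  set U : Matrix (Fin n) (Fin n) ℂ := (hg'.eigenvectorUnitary : Matrix (Fin n) (Fin n) ℂ) with hU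
  have hUU : U.conjTranspose * U = 1 := by
    rw [← Matrix.star_eq_conjTranspose]
    exact Unitary.coe_star_mul_self _
  refine ⟨B⁻¹ * U, hg'.eigenvalues, ?_, ?_⟩
  · rw [hB, Matrix.conjTranspose_mul]
    calc U.conjTranspose * B⁻¹.conjTranspose * (B.conjTranspose * B) * (B⁻¹ * U)
        = U.conjTranspose * (B * B⁻¹).conjTranspose * (B * B⁻¹) * U := by
          rw [Matrix.conjTranspose_mul]; simp only [Matrix.mul_assoc]
      _ = 1 := by rw [Matrix.mul_nonsing_inv _ hdet]; simpa using hUU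
  · have h := hg'.conjStarAlgAut_star_eigenvectorUnitary
    rw [Unitary.conjStarAlgAut_star_apply] at h
    rw [Matrix.conjTranspose_mul]
    calc U.conjTranspose * B⁻¹.conjTranspose * g * (B⁻¹ * U)
        = U.conjTranspose * (B⁻¹.conjTranspose * g * B⁻¹) * U := by
          simp only [Matrix.mul_assoc]
      _ = _ := h

/-- The coefficient of `t ^ k` in `det (a + t g)`. -/
def mixedDet {n : ℕ} (k : ℕ) (a g : Matrix (Fin n) (Fin n) ℂ) : ℂ :=
  ∑ s ∈ Finset.univ.powersetCard k, Matrix.det (Matrix.of fun i => if i ∈ s then g i else a i)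

lemma det_add_smul_eq_sum {n : ℕ} (a g : Matrix (Fin n) (Fin n) ℂ) (t : ℂ) :
    (t • g + a).det = ∑ k ∈ Finset.range (n + 1), mixedDet k a g * t ^ k := by
  have h := (Matrix.detRowAlternating (n := Fin n) (R := ℂ)).toMultilinearMap.map_add_univ (t • g) a
  have h1 : ∀ s : Finset (Fin n), Matrix.det (Matrix.of fun i => if i ∈ s then t • g i else a i)
      = Matrix.det (Matrix.of fun i => if i ∈ s then g i else a i) * t ^ s.card := by
    intro s
    have h2 := (Matrix.detRowAlternating (n := Fin n) (R := ℂ)).toMultilinearMap.map_piecewise_smul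
      (fun _ => t) (fun i => if i ∈ s then g i else a i) s
    have h3 : s.piecewise (fun i => t • (if i ∈ s then g i else a i))
        (fun i => if i ∈ s then g i else a i) = fun i => if i ∈ s then t • g i else a i := by
      ext i j
      by_cases hi : i ∈ s <;> simp [hi]
    rw [h3] at h2
    rw [Finset.prod_const, smul_eq_mul, mul_comm] at h2
    exact h2
  calc (t • g + a).det
      = ∑ s : Finset (Fin n), Matrix.det (Matrix.of fun i => if i ∈ s then t • g i else a i) := h
    _ = ∑ s ∈ (Finset.univ : Finset (Fin n)).powerset,
          Matrix.det (Matrix.of fun i => if i ∈ s then g i else a i) * t ^ s.card := by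
        rw [Finset.powerset_univ]; exact Finset.sum_congr rfl fun s _ => h1 s
    _ = _ := by
        rw [Finset.sum_powerset, Finset.card_univ, Fintype.card_fin]
        refine Finset.sum_congr rfl fun k _ => ?_
        rw [mixedDet, Finset.sum_mul]
        refine Finset.sum_congr rfl fun s hs => ?_
        rw [(Finset.mem_powersetCard.1 hs).2]

lemma prod_one_add_mul_eq_sum {n : ℕ} (lam : Fin n → ℝ) (t : ℂ) :
    ∏ i, (1 + t * (lam i : ℂ)) = ∑ k ∈ Finset.range (n + 1), (esymm k lam : ℂ) * t ^ k := by
  rw [Finset.prod_one_add, Finset.sum_powerset, Finset.card_univ, Fintype.card_fin]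
  refine Finset.sum_congr rfl fun k _ => ?_
  rw [esymm, Complex.ofReal_sum, Finset.sum_mul]
  refine Finset.sum_congr rfl fun s hs => ?_
  rw [Finset.prod_mul_distrib, Finset.prod_const, (Finset.mem_powersetCard.1 hs).2,
    Complex.ofReal_prod, mul_comm]

open Polynomial in
lemma IsEigenvalues.mixedDet_eq {n : ℕ} {a g : Matrix (Fin n) (Fin n) ℂ} {lam : Fin n → ℝ}
    (h : IsEigenvalues a g lam) {k : ℕ} (hk : k ≤ n) :
    mixedDet k a g = a.det * (esymm k lam : ℂ) := by
  set p : ℂ[X] := ∑ k ∈ Finset.range (n + 1), C (mixedDet k a g) * X ^ k with hp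
  set q : ℂ[X] := ∑ k ∈ Finset.range (n + 1), C (a.det * (esymm k lam : ℂ)) * X ^ k with hq
  have hpq : p = q := by
    refine eq_of_infinite_eval_eq p q (Set.Infinite.mono (s := (Set.Ioi (0 : ℝ)).image Complex.ofReal) ?_
      ((Set.Ioi_infinite 0).image Complex.ofReal_injective.injOn))
    rintro _ ⟨t, ht, rfl⟩
    have ht0 : (t : ℂ) ≠ 0 := by exact_mod_cast (ne_of_gt ht)
    have h1 : eval (t : ℂ) p = ((t : ℂ) • g + a).det := by
      rw [det_add_smul_eq_sum, hp]; simp [eval_finsetSum]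
    have h2 : eval (t : ℂ) q = a.det * ∏ i, (1 + (t : ℂ) * (lam i : ℂ)) := by
      rw [prod_one_add_mul_eq_sum, hq, Finset.mul_sum]; simp [eval_finsetSum, mul_assoc]
    have h3 := h (-t⁻¹)
    have h4 : (t : ℂ) • g + a = (t : ℂ) • (g - ((-t⁻¹ : ℝ) : ℂ) • a) := by
      rw [smul_sub, smul_smul]
      push_cast
      rw [mul_neg, mul_inv_cancel₀ ht0]
      simp
    show eval (t : ℂ) p = eval (t : ℂ) q
    rw [h1, h2, h4, Matrix.det_smul, h3, mul_left_comm, Fintype.card_fin]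
    congr 1
    rw [← Fin.prod_const, ← Finset.prod_mul_distrib]
    refine Finset.prod_congr rfl fun i _ => ?_
    push_cast
    field_simp
    ring
  have := congrArg (fun r => coeff r k) hpq
  simpa [hp, hq, finsetSum_coeff, -map_mul, coeff_C_mul, coeff_X_pow, Nat.lt_succ_iff, hk] using this

lemma IsEigenvalues.conj {n : ℕ} {a g : Matrix (Fin n) (Fin n) ℂ} {lam : Fin n → ℝ}
    (h : IsEigenvalues a g lam) (P : Matrix (Fin n) (Fin n) ℂ) :
    IsEigenvalues (P.conjTranspose * a * P) (P.conjTranspose * g * P) lam := by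
  intro t
  have : P.conjTranspose * g * P - (t : ℂ) • (P.conjTranspose * a * P)
      = P.conjTranspose * (g - (t : ℂ) • a) * P := by
    rw [Matrix.mul_sub, Matrix.sub_mul, Matrix.mul_smul, Matrix.smul_mul]
  rw [this, Matrix.det_mul, Matrix.det_mul, h t, Matrix.det_mul, Matrix.det_mul]
  ring

lemma isEigenvalues_one_diagonal {n : ℕ} (μ : Fin n → ℝ) :
    IsEigenvalues 1 (Matrix.diagonal fun i => (μ i : ℂ)) μ := by
  intro t
  rw [Matrix.smul_one_eq_diagonal, Matrix.diagonal_sub, Matrix.det_diagonal, Matrix.det_one,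
    one_mul]

lemma hasDerivAt_det_of_diagonal {n : ℕ} {M : ℝ → Matrix (Fin n) (Fin n) ℂ}
    {M' : Matrix (Fin n) (Fin n) ℂ} {d : Fin n → ℂ} {x : ℝ}
    (hM : ∀ i j, HasDerivAt (fun t => M t i j) (M' i j) x) (hd : M x = Matrix.diagonal d) :
    HasDerivAt (fun t => (M t).det) (∑ i, (∏ j ∈ Finset.univ.erase i, d j) * M' i i) x := by
  simp only [Matrix.det_apply]
  have h : ∀ σ : Equiv.Perm (Fin n), HasDerivAt
      (fun t => Equiv.Perm.sign σ • ∏ i, M t (σ i) i)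
      (Equiv.Perm.sign σ • ∑ i, (∏ j ∈ Finset.univ.erase i, M x (σ j) j) • M' (σ i) i) x :=
    fun σ => (HasDerivAt.fun_finsetProd fun i _ => hM (σ i) i).const_smul (Equiv.Perm.sign σ)
  have h2 := HasDerivAt.fun_sum fun σ (_ : σ ∈ Finset.univ) => h σ
  refine h2.congr_deriv ?_
  rw [Finset.sum_eq_single (1 : Equiv.Perm (Fin n))]
  · simp [hd]
  · intro σ _ hσ
    rw [Finset.sum_eq_zero, smul_zero]
    intro i _
    have : ∃ j, j ≠ i ∧ σ j ≠ j := by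
      by_contra! hcon
      refine hσ (Equiv.ext fun j => ?_)
      by_cases hj : j = i
      · subst hj
        by_contra hne
        have h3 := hcon (σ j) hne
        exact hne (σ.injective h3)
      · exact hcon j hj
    obtain ⟨j, hji, hj⟩ := this
    rw [Finset.prod_eq_zero (Finset.mem_erase.2 ⟨hji, Finset.mem_univ j⟩), zero_smul]
    rw [hd, Matrix.diagonal_apply_ne _ hj]
  · simp

lemma sum_powersetCard_ite_mem {n : ℕ} (k : ℕ) (i : Fin n) (μ : Fin n → ℝ) (x y : ℂ) :
    ∑ s ∈ (Finset.univ : Finset (Fin n)).powersetCard (k + 1),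
      (∏ j ∈ s.erase i, (μ j : ℂ)) * (if i ∈ s then x else y)
      = (esymmOn (Finset.univ.erase i) k μ : ℂ) * x
        + (esymmOn (Finset.univ.erase i) (k + 1) μ : ℂ) * y := by
  have hi := Finset.notMem_erase i (Finset.univ : Finset (Fin n))
  conv_lhs => rw [← Finset.insert_erase (Finset.mem_univ i)]
  have hmem : ∀ k, ∀ t ∈ (Finset.univ.erase i).powersetCard k, i ∉ t :=
    fun k t ht h => hi ((Finset.mem_powersetCard.1 ht).1 h)
  rw [Finset.powersetCard_succ_insert hi, Finset.sum_union, Finset.sum_image, add_comm]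
  · unfold esymmOn
    rw [Complex.ofReal_sum, Complex.ofReal_sum, Finset.sum_mul, Finset.sum_mul]
    congr 1
    · refine Finset.sum_congr rfl fun t ht => ?_
      rw [Finset.erase_insert (hmem k t ht), if_pos (Finset.mem_insert_self _ _),
        Complex.ofReal_prod]
    · refine Finset.sum_congr rfl fun t ht => ?_
      rw [Finset.erase_eq_of_notMem (hmem _ t ht), if_neg (hmem _ t ht), Complex.ofReal_prod]
  · intro t ht t' ht' h
    rw [← Finset.erase_insert (hmem k t ht), ← Finset.erase_insert (hmem k t' ht')]
    exact congrArg (fun x => Finset.erase x i) h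
  · rw [Finset.disjoint_left]
    intro t ht ht'
    obtain ⟨t', -, rfl⟩ := Finset.mem_image.1 ht'
    exact hmem _ _ ht (Finset.mem_insert_self _ _)

lemma hasDerivAt_mixedDet {n k : ℕ} {a b : ℝ → Matrix (Fin n) (Fin n) ℂ}
    {a' b' : Matrix (Fin n) (Fin n) ℂ} {μ : Fin n → ℝ} {x : ℝ}
    (ha : ∀ i j, HasDerivAt (fun t => a t i j) (a' i j) x)
    (hb : ∀ i j, HasDerivAt (fun t => b t i j) (b' i j) x)
    (ha0 : a x = 1) (hb0 : b x = Matrix.diagonal fun i => (μ i : ℂ)) :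
    HasDerivAt (fun t => mixedDet (k + 1) (a t) (b t))
      (∑ i, ((esymmOn (Finset.univ.erase i) k μ : ℂ) * b' i i
        + (esymmOn (Finset.univ.erase i) (k + 1) μ : ℂ) * a' i i)) x := by
  unfold mixedDet
  have h : ∀ s : Finset (Fin n), HasDerivAt
      (fun t => Matrix.det (Matrix.of fun i => if i ∈ s then b t i else a t i))
      (∑ i, (∏ j ∈ s.erase i, (μ j : ℂ)) * (if i ∈ s then b' i i else a' i i)) x := by
    intro s
    have h1 := hasDerivAt_det_of_diagonal
      (M := fun t => Matrix.of fun i => if i ∈ s then b t i else a t i)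
      (M' := Matrix.of fun i => if i ∈ s then b' i else a' i) (x := x)
      (d := fun i => if i ∈ s then (μ i : ℂ) else 1) (by
        intro i j
        by_cases hi : i ∈ s
        · simpa [hi] using hb i j
        · simpa [hi] using ha i j) (by
        ext i j
        by_cases hi : i ∈ s
        · simp [hi, hb0, Matrix.diagonal_apply]
        · simp [hi, ha0, Matrix.diagonal_apply, Matrix.one_apply])
    refine h1.congr_deriv ?_
    refine Finset.sum_congr rfl fun i _ => ?_
    congr 1
    · rw [Finset.prod_ite, Finset.prod_const_one, mul_one]
      refine Finset.prod_congr ?_ fun _ _ => rfl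
      ext j; simp [and_comm]
    · by_cases hi : i ∈ s <;> simp [hi]
  have h2 := HasDerivAt.fun_sum fun s (_ : s ∈ Finset.univ.powersetCard (k + 1)) => h s
  refine h2.congr_deriv ?_
  rw [Finset.sum_comm]
  exact Finset.sum_congr rfl fun i _ => sum_powersetCard_ite_mem k i μ _ _

/-- The differentiated equation `S_{k+1}(λ) = f`, in coordinates diagonalising the
forms at the point under consideration. -/
lemma sum_linearization_eq {n k : ℕ} {a b : ℝ → Matrix (Fin n) (Fin n) ℂ}
    {a' b' : Matrix (Fin n) (Fin n) ℂ} {μ : Fin n → ℝ} {x : ℝ} {f : ℝ → ℝ} {f' : ℝ}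
    (ha : ∀ i j, HasDerivAt (fun t => a t i j) (a' i j) x)
    (hb : ∀ i j, HasDerivAt (fun t => b t i j) (b' i j) x)
    (ha0 : a x = 1) (hb0 : b x = Matrix.diagonal fun i => (μ i : ℂ))
    (hf : HasDerivAt f f' x)
    (heq : ∀ᶠ t in nhds x, mixedDet (k + 1) (a t) (b t) = (a t).det * (f t : ℂ))
    (hfx : esymm (k + 1) μ = f x) :
    ∑ i, esymmOn (Finset.univ.erase i) k μ * (b' i i).re
      = f' + ∑ i, μ i * esymmOn (Finset.univ.erase i) k μ * (a' i i).re := by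
  have h1 := hasDerivAt_mixedDet (k := k) ha hb ha0 hb0
  have h2 := hasDerivAt_det_of_diagonal (d := 1) ha (by rw [ha0]; exact Matrix.diagonal_one.symm)
  have h3 := h2.mul hf.ofReal_comp
  have h4 := h1.unique (h3.congr_of_eventuallyEq heq)
  rw [ha0] at h4
  simp only [Pi.one_apply, Finset.prod_const_one, one_mul, Matrix.det_one] at h4
  have h5 := congrArg Complex.re h4
  simp only [Complex.re_sum, Complex.add_re, Complex.mul_re,
    Complex.ofReal_re, Complex.ofReal_im, mul_zero, sub_zero, Finset.sum_add_distrib] at h5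
  rw [← hfx] at h5
  have h6 : ∀ i, esymmOn (Finset.univ.erase i) (k + 1) μ
      = esymm (k + 1) μ - μ i * esymmOn (Finset.univ.erase i) k μ := fun i => by
    rw [esymm_eq_erase i k μ]; ring
  simp only [h6, sub_mul, Finset.sum_sub_distrib, ← Finset.mul_sum] at h5
  linarith

/-- Directional derivative of `f` in the direction `v`. -/
def dirDeriv {E F : Type*} [NormedAddCommGroup E] [NormedSpace ℝ E] [NormedAddCommGroup F]
    [NormedSpace ℝ F] (v : E) (f : E → F) (z : E) : F :=
  fderiv ℝ f z v

section DirDeriv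

variable {E F : Type*} [NormedAddCommGroup E] [NormedSpace ℝ E] [NormedAddCommGroup F]
  [NormedSpace ℝ F]

lemma ContDiffOn.dirDeriv {f : E → F} {U : Set E} (hU : IsOpen U) (hf : ContDiffOn ℝ ∞ f U)
    (v : E) : ContDiffOn ℝ ∞ (dirDeriv v f) U :=
  (hf.fderiv_of_isOpen hU (by simp)).clm_apply contDiffOn_const

lemma ContDiffOn.differentiableAt_of_isOpen {f : E → F} {U : Set E} (hU : IsOpen U)
    (hf : ContDiffOn ℝ ∞ f U) {z : E} (hz : z ∈ U) : DifferentiableAt ℝ f z :=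
  (hf.contDiffAt (hU.mem_nhds hz)).differentiableAt (by simp)

lemma dirDeriv_dirDeriv {f : E → F} {U : Set E} (hU : IsOpen U) (hf : ContDiffOn ℝ ∞ f U)
    {z : E} (hz : z ∈ U) (v w : E) :
    dirDeriv v (dirDeriv w f) z = fderiv ℝ (fderiv ℝ f) z v w := by
  have h : DifferentiableAt ℝ (fderiv ℝ f) z :=
    (hf.fderiv_of_isOpen hU (m := ∞) (by simp)).differentiableAt_of_isOpen hU hz
  have h1 := h.hasFDerivAt.clm_apply (hasFDerivAt_const w z)
  unfold dirDeriv
  rw [h1.fderiv]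
  simp

lemma dirDeriv_comm {f : E → F} {U : Set E} (hU : IsOpen U) (hf : ContDiffOn ℝ ∞ f U)
    {z : E} (hz : z ∈ U) (v w : E) :
    dirDeriv v (dirDeriv w f) z = dirDeriv w (dirDeriv v f) z := by
  rw [dirDeriv_dirDeriv hU hf hz, dirDeriv_dirDeriv hU hf hz]
  refine (hf.contDiffAt (hU.mem_nhds hz)).isSymmSndFDerivAt ?_ v w
  rw [minSmoothness_of_isRCLikeNormedField]
  exact WithTop.coe_le_coe.2 le_top

lemma dirDeriv_congr {f g : E → F} {U : Set E} (hU : IsOpen U) (h : ∀ z ∈ U, f z = g z) {z : E}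
    (hz : z ∈ U) (v : E) : dirDeriv v f z = dirDeriv v g z := by
  have : f =ᶠ[nhds z] g := Filter.eventually_of_mem (hU.mem_nhds hz) h
  unfold dirDeriv
  rw [this.fderiv_eq]

lemma dirDeriv_dirDeriv_dirDeriv_comm {f : E → F} {U : Set E} (hU : IsOpen U)
    (hf : ContDiffOn ℝ ∞ f U) {z : E} (hz : z ∈ U) (v w : E) :
    dirDeriv v (dirDeriv v (dirDeriv w f)) z = dirDeriv w (dirDeriv v (dirDeriv v f)) z := by
  rw [dirDeriv_congr hU (fun y hy => dirDeriv_comm hU hf hy v w) hz,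
    dirDeriv_comm hU (hf.dirDeriv hU v) hz]

lemma hasDerivAt_dirDeriv {f : E → F} {z v : E} (hf : DifferentiableAt ℝ f z) :
    HasDerivAt (fun t : ℝ => f (z + t • v)) (dirDeriv v f z) 0 := by
  have h1 : HasDerivAt (fun t : ℝ => z + t • v) v 0 := by
    simpa using ((hasDerivAt_id (0 : ℝ)).smul_const v).const_add z
  have h2 : HasFDerivAt f (fderiv ℝ f z) (z + (0 : ℝ) • v) := by simpa using hf.hasFDerivAt
  exact h2.comp_hasDerivAt (0 : ℝ) h1

lemma deriv_line {f : E → F} {U : Set E} (hU : IsOpen U) (hf : ContDiffOn ℝ ∞ f U) (z v : E)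
    {t : ℝ} (ht : z + t • v ∈ U) :
    HasDerivAt (fun t : ℝ => f (z + t • v)) (dirDeriv v f (z + t • v)) t := by
  have h1 : HasDerivAt (fun t : ℝ => z + t • v) v t := by
    simpa using ((hasDerivAt_id t).smul_const v).const_add z
  exact (hf.differentiableAt_of_isOpen hU ht).hasFDerivAt.comp_hasDerivAt t h1

lemma deriv_two_nonpos_of_isLocalMax {φ : ℝ → ℝ} {x d : ℝ} (h : IsLocalMax φ x)
    (hc : ContinuousAt φ x) (hd : HasDerivAt (deriv φ) d x) : d ≤ 0 := by
  by_contra hpos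
  push Not at hpos
  have hmin : IsLocalMin φ x :=
    isLocalMin_of_deriv_deriv_pos (by rw [hd.deriv]; exact hpos) h.deriv_eq_zero hc
  have hconst : φ =ᶠ[nhds x] fun _ => φ x := by
    filter_upwards [h, hmin] with y h1 h2
    exact le_antisymm h1 h2
  have h3 := hconst.deriv.deriv_eq
  rw [hd.deriv] at h3
  simp at h3
  exact hpos.ne' h3

/-- Second order condition at a maximum of `f` plus a multiple of a function which is
quadratic along lines. -/
lemma dirDeriv_dirDeriv_le_of_isLocalMax {f ρ : E → ℝ} {U : Set E} (hU : IsOpen U)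
    (hf : ContDiffOn ℝ ∞ f U) {z v : E} (hz : z ∈ U) {A B : ℝ}
    (hmax : IsLocalMax (fun y => f y + ρ y) z)
    (hρ : ∀ t : ℝ, ρ (z + t • v) = ρ z + A * t + B * t ^ 2) :
    dirDeriv v (dirDeriv v f) z ≤ -(2 * B) := by
  have hcont : Continuous fun t : ℝ => z + t • v := by fun_prop
  have hev : ∀ᶠ t : ℝ in nhds 0, z + t • v ∈ U :=
    hcont.continuousAt.eventually (by simpa using hU.mem_nhds hz)
  set φ : ℝ → ℝ := fun t => f (z + t • v) + (ρ z + A * t + B * t ^ 2) with hφ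
  have hd1 : ∀ t : ℝ, z + t • v ∈ U →
      HasDerivAt φ (dirDeriv v f (z + t • v) + (A + B * (2 * t))) t := by
    intro t ht
    refine (deriv_line hU hf z v ht).add ?_
    have h1 : HasDerivAt (fun t : ℝ => ρ z + A * t + B * t ^ 2) (A * 1 + B * (2 * t)) t := by
      refine (((hasDerivAt_id t).const_mul A).const_add (ρ z)).add
        (HasDerivAt.const_mul B ?_)
      simpa using hasDerivAt_pow 2 t
    simpa using h1
  have h0 : z + (0 : ℝ) • v ∈ U := by simpa using hz
  have hd2 : HasDerivAt (deriv φ) (dirDeriv v (dirDeriv v f) z + 2 * B) 0 := by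
    have h1 : deriv φ =ᶠ[nhds 0] fun t => dirDeriv v f (z + t • v) + (A + B * (2 * t)) := by
      filter_upwards [hev] with t ht
      exact (hd1 t ht).deriv
    refine HasDerivAt.congr_of_eventuallyEq ?_ h1
    have h2 := deriv_line hU (hf.dirDeriv hU v) z v h0
    simp only [zero_smul, add_zero] at h2
    refine h2.add ?_
    have h3 := ((((hasDerivAt_id (0 : ℝ)).const_mul 2).const_mul B).const_add A)
    simpa [mul_comm] using h3
  have hloc : IsLocalMax φ 0 := by
    have h1 : Filter.Tendsto (fun t : ℝ => z + t • v) (nhds 0) (nhds z) := by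
      simpa using hcont.tendsto (0 : ℝ)
    have h2 := h1.eventually hmax
    refine h2.mono fun t ht => ?_
    simp only [hρ] at ht
    simpa [hφ] using ht
  have := deriv_two_nonpos_of_isLocalMax hloc (hd1 0 h0).continuousAt hd2
  linarith

lemma dirDeriv_dirDeriv_sum_sq {ι : Type*} [Fintype ι] {w : ι → E → ℝ} {U : Set E}
    (hU : IsOpen U) (hw : ∀ j, ContDiffOn ℝ ∞ (w j) U) {z : E} (hz : z ∈ U) (v : E) :
    dirDeriv v (dirDeriv v fun y => ∑ j, w j y ^ 2) z
      = 2 * ∑ j, (w j z * dirDeriv v (dirDeriv v (w j)) z + dirDeriv v (w j) z ^ 2) := by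
  have h1 : ∀ y ∈ U, dirDeriv v (fun y => ∑ j, w j y ^ 2) y
      = ∑ j, 2 * (w j y * dirDeriv v (w j) y) := by
    intro y hy
    have h2 := HasFDerivAt.fun_sum fun j (_ : j ∈ Finset.univ) =>
      ((hw j).differentiableAt_of_isOpen hU hy).hasFDerivAt.pow 2
    unfold dirDeriv
    rw [h2.fderiv]
    simp [mul_assoc]
  rw [dirDeriv_congr hU h1 hz, Finset.mul_sum]
  have h3 := HasFDerivAt.fun_sum fun j (_ : j ∈ Finset.univ) =>
    (((hw j).differentiableAt_of_isOpen hU hz).hasFDerivAt.mul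
      (((hw j).dirDeriv hU v).differentiableAt_of_isOpen hU hz).hasFDerivAt).const_mul 2
  simp only [Pi.mul_apply] at h3
  rw [dirDeriv.eq_def, h3.fderiv]
  simp only [sum_apply, smul_apply,
    add_apply, smul_eq_mul]
  refine Finset.sum_congr rfl fun j _ => ?_
  unfold dirDeriv
  ring

end DirDeriv

/-- `∂_v ∂_v + ∂_{iv} ∂_{iv}`, four times the complex Hessian in the direction `v`. -/
def lineLaplacian {n : ℕ} (v : Cn n) (f : Cn n → ℝ) (z : Cn n) : ℝ :=
  dirDeriv v (dirDeriv v f) z + dirDeriv (Complex.I • v) (dirDeriv (Complex.I • v) f) z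

lemma ContDiffOn.lineLaplacian {n : ℕ} {f : Cn n → ℝ} {U : Set (Cn n)} (hU : IsOpen U)
    (hf : ContDiffOn ℝ ∞ f U) (v : Cn n) : ContDiffOn ℝ ∞ (lineLaplacian v f) U :=
  ((hf.dirDeriv hU _).dirDeriv hU _).add ((hf.dirDeriv hU _).dirDeriv hU _)

lemma lineLaplacian_dirDeriv {n : ℕ} {f : Cn n → ℝ} {U : Set (Cn n)} (hU : IsOpen U)
    (hf : ContDiffOn ℝ ∞ f U) {z : Cn n} (hz : z ∈ U) (v w : Cn n) :
    lineLaplacian v (dirDeriv w f) z = dirDeriv w (lineLaplacian v f) z := by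
  have hd : ∀ v, DifferentiableAt ℝ (dirDeriv v (dirDeriv v f)) z := fun v =>
    ((hf.dirDeriv hU _).dirDeriv hU _).differentiableAt_of_isOpen hU hz
  have h1 : dirDeriv w (lineLaplacian v f) z = dirDeriv w (dirDeriv v (dirDeriv v f)) z
      + dirDeriv w (dirDeriv (Complex.I • v) (dirDeriv (Complex.I • v) f)) z := by
    have := (hd v).hasFDerivAt.add (hd (Complex.I • v)).hasFDerivAt
    show fderiv ℝ (dirDeriv v (dirDeriv v f)
      + dirDeriv (Complex.I • v) (dirDeriv (Complex.I • v) f)) z w = _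
    rw [this.fderiv]
    rfl
  rw [h1, lineLaplacian, dirDeriv_dirDeriv_dirDeriv_comm hU hf hz,
    dirDeriv_dirDeriv_dirDeriv_comm hU hf hz]

/-- The standard real basis of `ℂ^n`. -/
def realBasis {n : ℕ} (q : Fin n × Bool) : Cn n :=
  EuclideanSpace.single q.1 (if q.2 then Complex.I else 1)

lemma norm_realBasis {n : ℕ} (q : Fin n × Bool) : ‖realBasis q‖ = 1 := by
  unfold realBasis
  rcases q with ⟨k, _ | _⟩ <;> simp

lemma sum_re_im_smul_realBasis {n : ℕ} (v : Cn n) :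
    v = ∑ q : Fin n × Bool, (if q.2 then (v q.1).im else (v q.1).re) • realBasis q := by
  ext k
  simp only [Fintype.sum_prod_type, Fintype.sum_bool, realBasis]
  simp [Finset.sum_apply, Pi.single_apply, Finset.sum_add_distrib, add_comm]

lemma sq_apply_le_norm_sq_mul_sum {n : ℕ} (l : Cn n →L[ℝ] ℝ) (v : Cn n) :
    l v ^ 2 ≤ ‖v‖ ^ 2 * ∑ q, l (realBasis q) ^ 2 := by
  have h1 : l v = ∑ q : Fin n × Bool,
      (if q.2 then (v q.1).im else (v q.1).re) * l (realBasis q) := by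
    conv_lhs => rw [sum_re_im_smul_realBasis v]
    simp only [map_sum, map_smul, smul_eq_mul]
  have h2 : ‖v‖ ^ 2 = ∑ q : Fin n × Bool, (if q.2 then (v q.1).im else (v q.1).re) ^ 2 := by
    rw [EuclideanSpace.norm_sq_eq, Fintype.sum_prod_type]
    refine Finset.sum_congr rfl fun k _ => ?_
    rw [Fintype.sum_bool, Complex.sq_norm, Complex.normSq_apply]
    simp; ring
  rw [h1, h2]
  exact Finset.sum_mul_sq_le_sq_mul_sq _ _ _

lemma norm_le_sqrt_sum_realBasis {n : ℕ} (l : Cn n →L[ℝ] ℝ) :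
    ‖l‖ ≤ Real.sqrt (∑ q, l (realBasis q) ^ 2) := by
  refine l.opNorm_le_bound (Real.sqrt_nonneg _) fun v => ?_
  rw [Real.norm_eq_abs]
  refine abs_le_of_sq_le_sq ?_ (by positivity)
  rw [mul_pow, Real.sq_sqrt (by positivity), mul_comm]
  exact sq_apply_le_norm_sq_mul_sum l v

/-- The Hermitian form of a real bilinear form on `ℂ^n`. -/
def hermPart {n : ℕ} (H : Cn n →L[ℝ] Cn n →L[ℝ] ℝ) (v w : Cn n) : ℂ :=
  ((H v w + H (Complex.I • v) (Complex.I • w) : ℝ) : ℂ)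
    + Complex.I * ((H v (Complex.I • w) - H (Complex.I • v) w : ℝ) : ℂ)

lemma complex_smul_eq {n : ℕ} (c : ℂ) (v : Cn n) : c • v = c.re • v + c.im • (Complex.I • v) := by
  ext k
  simp only [PiLp.smul_apply, PiLp.add_apply, smul_eq_mul, Complex.real_smul]
  conv_lhs => rw [← Complex.re_add_im c]
  ring

lemma hermPart_smul_left {n : ℕ} (H : Cn n →L[ℝ] Cn n →L[ℝ] ℝ) (c : ℂ) (v w : Cn n) :
    hermPart H (c • v) w = c * hermPart H v w := by
  have h2 : Complex.I • (c • v) = c.re • (Complex.I • v) - c.im • v := by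
    rw [smul_smul, complex_smul_eq]
    simp
    abel
  unfold hermPart
  rw [h2, complex_smul_eq c v]
  simp only [map_add, map_sub, map_smul, add_apply,
    sub_apply, smul_apply, smul_eq_mul]
  apply Complex.ext <;> simp <;> ring

lemma hermPart_smul_right {n : ℕ} (H : Cn n →L[ℝ] Cn n →L[ℝ] ℝ) (c : ℂ) (v w : Cn n) :
    hermPart H v (c • w) = starRingEnd ℂ c * hermPart H v w := by
  have h2 : Complex.I • (c • w) = c.re • (Complex.I • w) - c.im • w := by
    rw [smul_smul, complex_smul_eq]
    simp
    abel
  unfold hermPart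
  rw [h2, complex_smul_eq c w]
  simp only [map_add, map_sub, map_smul, smul_eq_mul]
  apply Complex.ext <;> simp <;> ring

lemma hermPart_sum_left {n : ℕ} (H : Cn n →L[ℝ] Cn n →L[ℝ] ℝ) {ι : Type*} (s : Finset ι)
    (f : ι → Cn n) (w : Cn n) : hermPart H (∑ i ∈ s, f i) w = ∑ i ∈ s, hermPart H (f i) w := by
  simp only [hermPart, Finset.smul_sum, map_sum, sum_apply,
    ← Finset.sum_add_distrib, ← Finset.sum_sub_distrib, Complex.ofReal_sum, Finset.mul_sum]

lemma hermPart_sum_right {n : ℕ} (H : Cn n →L[ℝ] Cn n →L[ℝ] ℝ) {ι : Type*} (s : Finset ι)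
    (f : ι → Cn n) (v : Cn n) : hermPart H v (∑ i ∈ s, f i) = ∑ i ∈ s, hermPart H v (f i) := by
  simp only [hermPart, Finset.smul_sum, map_sum,
    ← Finset.sum_add_distrib, ← Finset.sum_sub_distrib, Complex.ofReal_sum, Finset.mul_sum]

lemma sum_smul_single {n : ℕ} (v : Cn n) : v = ∑ k, v k • EuclideanSpace.single k (1 : ℂ) := by
  ext k
  simp [Finset.sum_apply, Pi.single_apply]

lemma hermPart_eq_sum {n : ℕ} (H : Cn n →L[ℝ] Cn n →L[ℝ] ℝ) (v w : Cn n) :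
    hermPart H v w = ∑ k, ∑ l, v k * hermPart H (EuclideanSpace.single k 1)
      (EuclideanSpace.single l 1) * starRingEnd ℂ (w l) := by
  conv_lhs => rw [sum_smul_single v, sum_smul_single w]
  rw [hermPart_sum_left]
  refine Finset.sum_congr rfl fun k _ => ?_
  rw [hermPart_sum_right]
  refine Finset.sum_congr rfl fun l _ => ?_
  rw [hermPart_smul_left, hermPart_smul_right]
  ring

/-- The real quadratic form of a matrix. -/
def quadForm {n : ℕ} (M : Matrix (Fin n) (Fin n) ℂ) (v : Cn n) : ℝ :=
  (∑ k, ∑ l, v k * M k l * starRingEnd ℂ (v l)).re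

lemma quadForm_add {n : ℕ} (M N : Matrix (Fin n) (Fin n) ℂ) (v : Cn n) :
    quadForm (M + N) v = quadForm M v + quadForm N v := by
  simp only [quadForm, Matrix.add_apply, mul_add, add_mul, Finset.sum_add_distrib, Complex.add_re]

lemma abs_quadForm_le {n : ℕ} (M : Matrix (Fin n) (Fin n) ℂ) (v : Cn n) :
    |quadForm M v| ≤ (∑ k, ∑ l, ‖M k l‖) * ‖v‖ ^ 2 := by
  refine (Complex.abs_re_le_norm _).trans ?_
  rw [Finset.sum_mul]
  refine norm_sum_le_of_le _ fun k _ => ?_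
  rw [Finset.sum_mul]
  refine norm_sum_le_of_le _ fun l _ => ?_
  rw [norm_mul, norm_mul, RCLike.norm_conj]
  have h1 := PiLp.norm_apply_le v k
  have h2 := PiLp.norm_apply_le v l
  calc ‖v k‖ * ‖M k l‖ * ‖v l‖ ≤ ‖v‖ * ‖M k l‖ * ‖v‖ := by gcongr
    _ = ‖M k l‖ * ‖v‖ ^ 2 := by ring

/-- The conjugate of the `i`-th column of `P`. -/
def conjCol {n : ℕ} (P : Matrix (Fin n) (Fin n) ℂ) (i : Fin n) : Cn n :=
  WithLp.toLp 2 fun k => starRingEnd ℂ (P k i)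

lemma conjTranspose_mul_mul_diag_re {n : ℕ} (P M : Matrix (Fin n) (Fin n) ℂ) (i : Fin n) :
    ((P.conjTranspose * M * P) i i).re = quadForm M (conjCol P i) := by
  unfold quadForm conjCol
  congr 1
  simp only [Matrix.mul_apply, Finset.sum_mul, Matrix.conjTranspose_apply, Complex.conj_conj]
  rw [Finset.sum_comm]
  rfl

lemma Matrix.PosDef.quadForm_pos {n : ℕ} {M : Matrix (Fin n) (Fin n) ℂ} (hM : M.PosDef) {v : Cn n}
    (hv : v ≠ 0) : 0 < quadForm M v := by
  have hx : (fun k => starRingEnd ℂ (v k)) ≠ 0 := by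
    contrapose! hv
    ext k
    simpa using congrFun hv k
  have h := hM.dotProduct_mulVec_pos hx
  refine (Complex.lt_def.1 h).1.trans_eq ?_
  unfold quadForm
  congr 1
  simp [dotProduct, Matrix.mulVec, Finset.mul_sum, mul_assoc]

section ComplexHessian

variable {n : ℕ} {δ : ℝ} {u : Cn n → ℝ}

lemma fderivWithin_closedBall {F : Type*} [NormedAddCommGroup F] [NormedSpace ℝ F]
    {f : Cn n → F} {z : Cn n} (hz : z ∈ ball (0 : Cn n) δ) :
    fderivWithin ℝ f (closedBall 0 δ) z = fderiv ℝ f z :=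
  fderivWithin_of_mem_nhds (Filter.mem_of_superset (isOpen_ball.mem_nhds hz) ball_subset_closedBall)

lemma cHessOn_eq_hermPart (hu : ContDiffOn ℝ ∞ u (ball 0 δ)) {z : Cn n}
    (hz : z ∈ ball (0 : Cn n) δ) (k l : Fin n) :
    cHessOn (closedBall 0 δ) u k l z = hermPart (fderiv ℝ (fderiv ℝ u) z)
      (EuclideanSpace.single k 1) (EuclideanSpace.single l 1) / 4 := by
  have hI : ∀ k : Fin n, (EuclideanSpace.single k Complex.I : Cn n)
      = Complex.I • EuclideanSpace.single k (1 : ℂ) := fun k => by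
    ext j
    simp
  have h1 : ∀ y ∈ ball (0 : Cn n) δ, wderBarOn (closedBall 0 δ) l (fun w => (u w : ℂ)) y
      = ((dirDeriv (EuclideanSpace.single l 1) u y : ℝ)
        + Complex.I * (dirDeriv (Complex.I • EuclideanSpace.single l 1) u y : ℝ)) / 2 := by
    intro y hy
    have hd := (hu.differentiableAt_of_isOpen isOpen_ball hy).hasFDerivAt
    have hd2 : HasFDerivAt (fun w => (u w : ℂ)) (Complex.ofRealCLM.comp (fderiv ℝ u y)) y :=
      Complex.ofRealCLM.hasFDerivAt.comp y hd
    unfold wderBarOn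
    rw [fderivWithin_closedBall hy, hd2.fderiv, hI]
    rfl
  have hev : wderBarOn (closedBall 0 δ) l (fun w => (u w : ℂ)) =ᶠ[nhds z] fun y =>
      ((dirDeriv (EuclideanSpace.single l 1) u y : ℝ)
        + Complex.I * (dirDeriv (Complex.I • EuclideanSpace.single l 1) u y : ℝ)) / 2 :=
    Filter.eventually_of_mem (isOpen_ball.mem_nhds hz) h1
  have hd : ∀ v, HasFDerivAt (fun y => ((dirDeriv v u y : ℝ) : ℂ))
      (Complex.ofRealCLM.comp (fderiv ℝ (dirDeriv v u) z)) z := fun v =>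
    Complex.ofRealCLM.hasFDerivAt.comp z
      ((hu.dirDeriv isOpen_ball v).differentiableAt_of_isOpen isOpen_ball hz).hasFDerivAt
  have hd3 := ((hd (EuclideanSpace.single l 1)).add
    ((hd (Complex.I • EuclideanSpace.single l 1)).const_mul Complex.I)).mul_const (2⁻¹ : ℂ)
  have hd4 := hd3.congr_of_eventuallyEq (f₁ := wderBarOn (closedBall 0 δ) l (fun w => (u w : ℂ)))
    (by simpa [div_eq_mul_inv] using hev)
  have hH : ∀ v w, fderiv ℝ (dirDeriv w u) z v = fderiv ℝ (fderiv ℝ u) z v w :=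
    fun v w => dirDeriv_dirDeriv isOpen_ball hu hz v w
  unfold cHessOn wderOn
  rw [fderivWithin_closedBall hz, hd4.fderiv, hI]
  simp only [smul_apply, add_apply,
    ContinuousLinearMap.comp_apply, smul_eq_mul, hH, hermPart, Complex.ofRealCLM_apply]
  push_cast
  linear_combination (-1 / 4 : ℂ) * (fderiv ℝ (fderiv ℝ u) z (Complex.I • EuclideanSpace.single k 1)
    (Complex.I • EuclideanSpace.single l 1) : ℂ) * Complex.I_mul_I

/-- The complex Hessian as a matrix. -/
def cHessMat (δ : ℝ) (u : Cn n → ℝ) (z : Cn n) : Matrix (Fin n) (Fin n) ℂ :=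
  Matrix.of fun k l => cHessOn (closedBall 0 δ) u k l z

lemma gMatOn_eq_add (χ : Cn n → Matrix (Fin n) (Fin n) ℂ) (z : Cn n) :
    gMatOn (closedBall 0 δ) χ u z = χ z + cHessMat δ u z := rfl

lemma contDiffOn_cHessMat (hu : ContDiffOn ℝ ∞ u (ball 0 δ)) (k l : Fin n) :
    ContDiffOn ℝ ∞ (fun z => cHessMat δ u z k l) (ball 0 δ) := by
  have h1 : ContDiffOn ℝ ∞ (fderiv ℝ (fderiv ℝ u)) (ball 0 δ) :=
    (hu.fderiv_of_isOpen isOpen_ball (m := ∞) (by simp)).fderiv_of_isOpen isOpen_ball (by simp)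
  have h2 : ∀ v w : Cn n, ContDiffOn ℝ ∞ (fun z => fderiv ℝ (fderiv ℝ u) z v w) (ball 0 δ) :=
    fun v w => (h1.clm_apply contDiffOn_const).clm_apply contDiffOn_const
  have h3 : ∀ {f : Cn n → ℝ}, ContDiffOn ℝ ∞ f (ball 0 δ) →
      ContDiffOn ℝ ∞ (fun z => (f z : ℂ)) (ball 0 δ) := fun hf =>
    Complex.ofRealCLM.contDiff.comp_contDiffOn hf
  refine ContDiffOn.congr ?_ fun z hz => cHessOn_eq_hermPart hu hz k l
  exact ((h3 ((h2 _ _).add (h2 _ _))).add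
    (contDiffOn_const.mul (h3 ((h2 _ _).sub (h2 _ _))))).div_const 4

lemma cHessMat_isHermitian (hu : ContDiffOn ℝ ∞ u (ball 0 δ)) {z : Cn n}
    (hz : z ∈ ball (0 : Cn n) δ) : (cHessMat δ u z).IsHermitian := by
  ext k l
  have hs : ∀ v w, fderiv ℝ (fderiv ℝ u) z v w = fderiv ℝ (fderiv ℝ u) z w v := fun v w => by
    rw [← dirDeriv_dirDeriv isOpen_ball hu hz, ← dirDeriv_dirDeriv isOpen_ball hu hz,
      dirDeriv_comm isOpen_ball hu hz]
  rw [Matrix.conjTranspose_apply]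
  simp only [cHessMat, Matrix.of_apply]
  rw [cHessOn_eq_hermPart hu hz, cHessOn_eq_hermPart hu hz]
  unfold hermPart
  rw [hs (EuclideanSpace.single l 1) (EuclideanSpace.single k 1),
    hs (Complex.I • EuclideanSpace.single l 1) (Complex.I • EuclideanSpace.single k 1),
    hs (EuclideanSpace.single l 1) (Complex.I • EuclideanSpace.single k 1),
    hs (Complex.I • EuclideanSpace.single l 1) (EuclideanSpace.single k 1)]
  apply Complex.ext <;> simp

lemma quadForm_cHessMat (hu : ContDiffOn ℝ ∞ u (ball 0 δ)) {z : Cn n}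
    (hz : z ∈ ball (0 : Cn n) δ) (v : Cn n) :
    quadForm (cHessMat δ u z) v = lineLaplacian v u z / 4 := by
  have h1 : quadForm (cHessMat δ u z) v
      = (hermPart (fderiv ℝ (fderiv ℝ u) z) v v / 4).re := by
    rw [hermPart_eq_sum, quadForm, Finset.sum_div]
    congr 1
    refine Finset.sum_congr rfl fun k _ => ?_
    rw [Finset.sum_div]
    refine Finset.sum_congr rfl fun l _ => ?_
    rw [cHessMat, Matrix.of_apply, cHessOn_eq_hermPart hu hz]
    ring
  rw [h1, lineLaplacian, dirDeriv_dirDeriv isOpen_ball hu hz, dirDeriv_dirDeriv isOpen_ball hu hz,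
    hermPart]
  simp

end ComplexHessian

/-- Entrywise directional derivative of a matrix-valued function. -/
def matDeriv {n : ℕ} (e : Cn n) (M : Cn n → Matrix (Fin n) (Fin n) ℂ) (z : Cn n) :
    Matrix (Fin n) (Fin n) ℂ :=
  Matrix.of fun k l => dirDeriv e (fun y => M y k l) z

lemma hasDerivAt_conj_matrix {n : ℕ} {M : Cn n → Matrix (Fin n) (Fin n) ℂ} {z e : Cn n}
    (hM : ∀ k l, DifferentiableAt ℝ (fun y => M y k l) z) (P : Matrix (Fin n) (Fin n) ℂ)
    (i j : Fin n) :
    HasDerivAt (fun t : ℝ => (P.conjTranspose * M (z + t • e) * P) i j)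
      ((P.conjTranspose * matDeriv e M z * P) i j) 0 := by
  simp only [Matrix.mul_apply]
  refine HasDerivAt.fun_sum fun l _ => HasDerivAt.mul_const ?_ _
  refine HasDerivAt.fun_sum fun k _ => HasDerivAt.const_mul _ ?_
  exact hasDerivAt_dirDeriv (hM k l)

lemma quadForm_matDeriv {n : ℕ} {M : Cn n → Matrix (Fin n) (Fin n) ℂ} {z : Cn n}
    (hM : ∀ k l, DifferentiableAt ℝ (fun y => M y k l) z) (e v : Cn n) :
    quadForm (matDeriv e M z) v = dirDeriv e (fun y => quadForm (M y) v) z := by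
  have h1 : HasFDerivAt (fun y => ∑ k, ∑ l, v k * M y k l * starRingEnd ℂ (v l)) _ z :=
    HasFDerivAt.fun_sum fun k (_ : k ∈ Finset.univ) => HasFDerivAt.fun_sum
      fun l (_ : l ∈ Finset.univ) => ((hM k l).hasFDerivAt.const_mul (v k)).mul_const
        (starRingEnd ℂ (v l))
  have h2 := Complex.reCLM.hasFDerivAt.comp z h1
  have h3 : dirDeriv e (fun y => quadForm (M y) v) z = _ := congrArg (fun l => l e) h2.fderiv
  rw [h3]
  simp only [quadForm, matDeriv, dirDeriv, Matrix.of_apply, ContinuousLinearMap.comp_apply,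
    sum_apply, smul_apply, smul_eq_mul,
    Complex.reCLM_apply]
  congr 1
  refine Finset.sum_congr rfl fun k _ => Finset.sum_congr rfl fun l _ => ?_
  ring

lemma abs_sum_mul_le_card {κ : Type*} [Fintype κ] {w b : κ → ℝ} {T B : ℝ}
    (hw : ∀ q, |w q| ≤ T) (hb : ∀ q, |b q| ≤ B) :
    |∑ q, w q * b q| ≤ Fintype.card κ * (T * B) := by
  refine (Finset.abs_sum_le_sum_abs _ _).trans ?_
  refine (Finset.sum_le_card_nsmul _ _ (T * B) fun q _ => ?_).trans (by simp)
  rw [abs_mul]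
  exact mul_le_mul (hw q) (hb q) (abs_nonneg _) ((abs_nonneg _).trans (hw q))

/-- Summation of the pointwise maximum-principle inequalities against the weights `F` of the
linearised operator. -/
lemma weighted_sum_le_of_linearization {ι κ : Type*} [Fintype ι] [Fintype κ]
    {F μ x X Q : ι → ℝ} {w d : κ → ℝ} {y a c : ι → κ → ℝ} {T R A H L : ℝ}
    (hF : ∀ i, 0 < F i) (hR : 0 < R) (hT : 1 ≤ T) (hA : 0 ≤ A)
    (hlin : ∀ q, ∑ i, F i * (c i q + y i q / 4) = d q + ∑ i, μ i * F i * a i q)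
    (hμ : ∀ i, μ i = X i + x i / 4) (hQ : ∀ i, x i ^ 2 ≤ 2 * R * Q i)
    (hmax : ∀ i, 2 * ∑ q, w q * y i q + 2 * Q i ≤ -(2 * L))
    (ha : ∀ i q, |a i q| ≤ A) (hc : ∀ i q, |c i q| ≤ A) (hX : ∀ i, |X i| ≤ A)
    (hw : ∑ q, w q ^ 2 ≤ T ^ 2) (hd : ∀ q, |d q| ≤ H) :
    (2 * L - T ^ 2 * (Fintype.card κ * (R * A ^ 2 + 8 * (A ^ 2 + A)))) * ∑ i, F i
      ≤ 8 * Fintype.card κ * (T * H) := by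
  have hT0 : 0 ≤ T := by linarith
  have hwq : ∀ q, |w q| ≤ T := fun q => abs_le_of_sq_le_sq
    ((Finset.single_le_sum (f := fun q => w q ^ 2) (fun q _ => sq_nonneg _)
      (Finset.mem_univ q)).trans hw) hT0
  set N := (Fintype.card κ : ℝ) with hN
  have hN0 : 0 ≤ N := Nat.cast_nonneg _
  have hpt : ∀ i, 8 * ∑ q, w q * c i q + 2 * ∑ q, w q * y i q - 8 * μ i * ∑ q, w q * a i q
      ≤ -(2 * L) + T ^ 2 * (N * (R * A ^ 2 + 8 * (A ^ 2 + A))) := by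
    intro i
    set S := ∑ q, w q * a i q with hS
    have h1 := (abs_le.1 (abs_sum_mul_le_card hwq (hc i))).2
    have h2 : |S| ≤ N * (T * A) := abs_sum_mul_le_card hwq (ha i)
    have h3 : S ^ 2 ≤ T ^ 2 * (N * A ^ 2) := by
      refine (Finset.sum_mul_sq_le_sq_mul_sq _ _ _).trans ?_
      refine mul_le_mul hw ?_ (Finset.sum_nonneg fun _ _ => sq_nonneg _) (sq_nonneg _)
      refine (Finset.sum_le_card_nsmul _ _ (A ^ 2) fun q _ => ?_).trans (by simp [hN])
      exact sq_le_sq' (abs_le.1 (ha i q)).1 (abs_le.1 (ha i q)).2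
    have h4 : -(2 * Q i) - 2 * x i * S ≤ R * S ^ 2 := by
      have h : 0 ≤ R * (R * S ^ 2 + 2 * Q i + 2 * x i * S) := by
        nlinarith [sq_nonneg (x i + R * S), hQ i]
      linarith [nonneg_of_mul_nonneg_right h hR]
    have h5 : -(X i * S) ≤ A * (N * (T * A)) := by
      refine (neg_le_abs _).trans ?_
      rw [abs_mul]
      exact mul_le_mul (hX i) h2 (abs_nonneg _) hA
    have h6 : N * (T * A) ≤ N * (T ^ 2 * A) := by
      gcongr
      nlinarith
    have h7 := mul_le_mul_of_nonneg_left h3 hR.le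
    have h8 := mul_le_mul_of_nonneg_left h6 hA
    rw [hμ i]
    linarith [hmax i]
  have hsum : ∑ i, F i * (8 * ∑ q, w q * c i q + 2 * ∑ q, w q * y i q
      - 8 * μ i * ∑ q, w q * a i q) = 8 * ∑ q, w q * d q := by
    have h1 : ∀ q, d q = ∑ i, F i * (c i q + y i q / 4 - μ i * a i q) := fun q => by
      rw [eq_sub_of_add_eq (hlin q).symm, ← Finset.sum_sub_distrib]
      exact Finset.sum_congr rfl fun i _ => by ring
    simp only [h1, Finset.mul_sum, ← Finset.sum_add_distrib, ← Finset.sum_sub_distrib]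
    rw [Finset.sum_comm]
    exact Finset.sum_congr rfl fun q _ => Finset.sum_congr rfl fun i _ => by ring
  have hle := Finset.sum_le_sum fun i (_ : i ∈ Finset.univ) =>
    mul_le_mul_of_nonneg_left (hpt i) (hF i).le
  rw [hsum, ← Finset.sum_mul] at hle
  have hd' := (abs_le.1 (abs_sum_mul_le_card hwq hd)).1
  linarith

lemma norm_sq_add_smul {n : ℕ} (c : ℝ) (z v : Cn n) (t : ℝ) :
    c * ‖z + t • v‖ ^ 2
      = c * ‖z‖ ^ 2 + 2 * c * (inner ℂ z v).re * t + c * ‖v‖ ^ 2 * t ^ 2 := by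
  have h : t • v = (t : ℂ) • v := (Complex.coe_smul t v).symm
  rw [@norm_add_sq ℂ, h, inner_smul_right, norm_smul]
  simp only [RCLike.re_to_complex, Complex.re_ofReal_mul, Complex.norm_real, Real.norm_eq_abs,
    mul_pow, sq_abs]
  ring

/-- The sum over real coordinate directions `q` of `|∂_v ∂_q u|² + |∂_{iv} ∂_q u|²`. -/
def mixedSecondSq {n : ℕ} (v : Cn n) (u : Cn n → ℝ) (z : Cn n) : ℝ :=
  ∑ q : Fin n × Bool, (dirDeriv v (dirDeriv (realBasis q) u) z ^ 2
    + dirDeriv (Complex.I • v) (dirDeriv (realBasis q) u) z ^ 2)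

lemma lineLaplacian_sq_le {n : ℕ} {u : Cn n → ℝ} {U : Set (Cn n)} (hU : IsOpen U)
    (hu : ContDiffOn ℝ ∞ u U) {z v : Cn n} (hz : z ∈ U) {R : ℝ} (hv : ‖v‖ ^ 2 ≤ R) :
    lineLaplacian v u z ^ 2 ≤ 2 * R * mixedSecondSq v u z := by
  have h : ∀ v : Cn n, dirDeriv v (dirDeriv v u) z ^ 2
      ≤ ‖v‖ ^ 2 * ∑ q, dirDeriv v (dirDeriv (realBasis q) u) z ^ 2 := fun v => by
    simp only [dirDeriv_comm hU hu hz v (realBasis _)]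
    exact sq_apply_le_norm_sq_mul_sum (fderiv ℝ (dirDeriv v u) z) v
  have h1 := h v
  have h2 := h (Complex.I • v)
  rw [norm_smul, Complex.norm_I, one_mul] at h2
  have h0 : 0 ≤ mixedSecondSq v u z := Finset.sum_nonneg fun _ _ => by positivity
  calc lineLaplacian v u z ^ 2
      ≤ 2 * (dirDeriv v (dirDeriv v u) z ^ 2
        + dirDeriv (Complex.I • v) (dirDeriv (Complex.I • v) u) z ^ 2) := add_sq_le
    _ ≤ 2 * (‖v‖ ^ 2 * mixedSecondSq v u z) := by
        rw [mixedSecondSq, Finset.sum_add_distrib]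
        linarith
    _ ≤ 2 * R * mixedSecondSq v u z := by
        rw [mul_assoc]
        gcongr

lemma lineLaplacian_le_of_isLocalMax {n : ℕ} {u : Cn n → ℝ} {U : Set (Cn n)} (hU : IsOpen U)
    (hu : ContDiffOn ℝ ∞ u U) {z : Cn n} (hz : z ∈ U) {c : ℝ}
    (hmax : IsLocalMax (fun y => ∑ q, dirDeriv (realBasis q) u y ^ 2 + c * ‖y‖ ^ 2) z)
    (v : Cn n) :
    2 * ∑ q, dirDeriv (realBasis q) u z * dirDeriv (realBasis q) (lineLaplacian v u) z
      + 2 * mixedSecondSq v u z ≤ -(4 * c * ‖v‖ ^ 2) := by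
  have hw : ∀ q, ContDiffOn ℝ ∞ (dirDeriv (realBasis q) u) U := fun q => hu.dirDeriv hU _
  have hW : ContDiffOn ℝ ∞ (fun y => ∑ q, dirDeriv (realBasis q) u y ^ 2) U :=
    ContDiffOn.sum fun q _ => (hw q).pow 2
  have h1 := dirDeriv_dirDeriv_le_of_isLocalMax hU hW hz hmax (norm_sq_add_smul c z v)
  have h2 := dirDeriv_dirDeriv_le_of_isLocalMax hU hW hz hmax
    (norm_sq_add_smul c z (Complex.I • v))
  rw [norm_smul, Complex.norm_I, one_mul] at h2
  rw [dirDeriv_dirDeriv_sum_sq hU hw hz] at h1 h2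
  simp only [← lineLaplacian_dirDeriv hU hu hz, lineLaplacian, mixedSecondSq, mul_add,
    Finset.sum_add_distrib] at h1 h2 ⊢
  linarith

lemma dirDeriv_quadForm_cHessMat {n : ℕ} {u : Cn n → ℝ} {δ : ℝ}
    (hu : ContDiffOn ℝ ∞ u (ball 0 δ)) {z : Cn n} (hz : z ∈ ball (0 : Cn n) δ) (e v : Cn n) :
    quadForm (matDeriv e (cHessMat δ u) z) v = dirDeriv e (lineLaplacian v u) z / 4 := by
  rw [quadForm_matDeriv
      (fun k l => (contDiffOn_cHessMat hu k l).differentiableAt_of_isOpen isOpen_ball hz),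
    dirDeriv_congr isOpen_ball (fun y hy => quadForm_cHessMat hu hy v) hz]
  have h := ((hu.lineLaplacian isOpen_ball v).differentiableAt_of_isOpen isOpen_ball hz)
    |>.hasFDerivAt.mul_const (4 : ℝ)⁻¹
  simp only [← div_eq_mul_inv] at h
  unfold dirDeriv
  rw [h.fderiv]
  simp [div_eq_inv_mul]

/-- A frame diagonalising the equation at `z`, together with the equation differentiated once in
every direction and expressed in that frame. -/
lemma exists_frame_linearization {n k : ℕ} (hkn : k + 1 ≤ n)
    {α χ : Cn n → Matrix (Fin n) (Fin n) ℂ} {u f : Cn n → ℝ} {δ : ℝ}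
    (hα : IsHermitianMetricOn α (ball 0 δ)) (hχ : IsRealFormOn χ (ball 0 δ))
    (hu : ContDiffOn ℝ ∞ u (ball 0 δ)) (hf : ContDiffOn ℝ ∞ f (ball 0 δ))
    (hsol : IsAdmissibleSolutionOn (k + 1) α χ (closedBall 0 δ) u f (ball 0 δ))
    {z : Cn n} (hz : z ∈ ball (0 : Cn n) δ) :
    ∃ (v : Fin n → Cn n) (μ : Fin n → ℝ), (∀ i, quadForm (α z) (v i) = 1) ∧
      μ ∈ GammaCone n (k + 1) ∧ esymm (k + 1) μ = f z ∧
      (∀ i, μ i = quadForm (χ z) (v i) + lineLaplacian (v i) u z / 4) ∧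
      ∀ e, ∑ i, esymmOn (Finset.univ.erase i) k μ * (quadForm (matDeriv e χ z) (v i)
          + dirDeriv e (lineLaplacian (v i) u) z / 4)
        = dirDeriv e f z + ∑ i, μ i * esymmOn (Finset.univ.erase i) k μ
          * quadForm (matDeriv e α z) (v i) := by
  obtain ⟨lam, hlam, hcone, hfz⟩ := hsol z hz
  obtain ⟨P, μ, hPa, hPg⟩ := exists_simultaneous_diagonalization (hα.2 z hz)
    ((hχ.2 z hz).add (cHessMat_isHermitian hu hz))
  have hesymm : ∀ j ≤ n, esymm j μ = esymm j lam := fun j hj => by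
    have h1 := (hlam.conj P).mixedDet_eq hj
    rw [gMatOn_eq_add, hPa, hPg, (isEigenvalues_one_diagonal μ).mixedDet_eq hj] at h1
    simpa using h1
  refine ⟨conjCol P, μ, fun i => ?_, fun j hj hjk => ?_, ?_, fun i => ?_, fun e => ?_⟩
  · rw [← conjTranspose_mul_mul_diag_re, hPa]
    simp
  · rw [hesymm j (hjk.trans hkn)]
    exact hcone j hj hjk
  · rw [hesymm _ hkn, hfz]
  · rw [← quadForm_cHessMat hu hz, ← quadForm_add, ← conjTranspose_mul_mul_diag_re, hPg]
    simp
  · have hev : ∀ᶠ t : ℝ in nhds 0, z + t • e ∈ ball (0 : Cn n) δ := by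
      have hc : Continuous fun t : ℝ => z + t • e := by fun_prop
      exact hc.continuousAt.eventually
        (by beta_reduce; rw [zero_smul, add_zero]; exact isOpen_ball.mem_nhds hz)
    have h := sum_linearization_eq (k := k)
      (a := fun t : ℝ => P.conjTranspose * α (z + t • e) * P)
      (b := fun t : ℝ => P.conjTranspose * χ (z + t • e) * P
        + P.conjTranspose * cHessMat δ u (z + t • e) * P) (f := fun t => f (z + t • e))
      (b' := P.conjTranspose * matDeriv e χ z * P
        + P.conjTranspose * matDeriv e (cHessMat δ u) z * P)
      (μ := μ) (x := 0)
      (hasDerivAt_conj_matrix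
        (fun k l => (hα.1 k l).differentiableAt_of_isOpen isOpen_ball hz) P)
      (fun i j => (hasDerivAt_conj_matrix
          (fun k l => (hχ.1 k l).differentiableAt_of_isOpen isOpen_ball hz) P i j).add
        (hasDerivAt_conj_matrix (fun k l =>
          (contDiffOn_cHessMat hu k l).differentiableAt_of_isOpen isOpen_ball hz) P i j))
      (by simpa using hPa)
      (by simpa [Matrix.mul_add, Matrix.add_mul] using hPg)
      (hasDerivAt_dirDeriv (hf.differentiableAt_of_isOpen isOpen_ball hz))
      (by
        filter_upwards [hev] with t ht
        obtain ⟨lam', hlam', -, hf'⟩ := hsol _ ht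
        have h1 := (hlam'.conj P).mixedDet_eq hkn
        rwa [gMatOn_eq_add, Matrix.mul_add, Matrix.add_mul, hf'] at h1)
      (by simp [hesymm _ hkn, hfz])
    simpa only [Matrix.add_apply, Complex.add_re, conjTranspose_mul_mul_diag_re,
      dirDeriv_quadForm_cHessMat hu hz] using h

/-- The maximum principle at an interior maximum of `|∇u|² + c|z|²`. -/
lemma interior_max_estimate {n k : ℕ} (hkn : k + 1 ≤ n)
    {α χ : Cn n → Matrix (Fin n) (Fin n) ℂ} {u f : Cn n → ℝ} {δ r R A H b T c : ℝ}
    (hα : IsHermitianMetricOn α (ball 0 δ)) (hχ : IsRealFormOn χ (ball 0 δ))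
    (hu : ContDiffOn ℝ ∞ u (ball 0 δ)) (hf : ContDiffOn ℝ ∞ f (ball 0 δ))
    (hsol : IsAdmissibleSolutionOn (k + 1) α χ (closedBall 0 δ) u f (ball 0 δ))
    {z : Cn n} (hz : z ∈ ball (0 : Cn n) δ) (hR : 0 < R) (hA : 0 ≤ A)
    (hv : ∀ v, quadForm (α z) v = 1 → r ≤ ‖v‖ ^ 2 ∧ ‖v‖ ^ 2 ≤ R)
    (hαA : ∀ q v, ‖v‖ ^ 2 ≤ R → |quadForm (matDeriv (realBasis q) α z) v| ≤ A)
    (hχA : ∀ q v, ‖v‖ ^ 2 ≤ R → |quadForm (matDeriv (realBasis q) χ z) v| ≤ A)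
    (hχ0 : ∀ v, ‖v‖ ^ 2 ≤ R → |quadForm (χ z) v| ≤ A)
    (hH : ∀ q, |dirDeriv (realBasis q) f z| ≤ H) (hb : 0 ≤ b) (hbf : b ^ (k + 1) ≤ f z)
    (hT : 1 ≤ T) (hW : ∑ q, dirDeriv (realBasis q) u z ^ 2 ≤ T ^ 2) (hc : 0 ≤ c)
    (hmax : IsLocalMax (fun y => ∑ q, dirDeriv (realBasis q) u y ^ 2 + c * ‖y‖ ^ 2) z)
    (hcT : T ^ 2 * (Fintype.card (Fin n × Bool) * (R * A ^ 2 + 8 * (A ^ 2 + A))) ≤ 4 * c * r) :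
    (4 * c * r - T ^ 2 * (Fintype.card (Fin n × Bool) * (R * A ^ 2 + 8 * (A ^ 2 + A)))) * b ^ k
      ≤ 8 * Fintype.card (Fin n × Bool) * (T * H) := by
  obtain ⟨v, μ, hv1, hμ, hμf, hμx, hlin⟩ := exists_frame_linearization hkn hα hχ hu hf hsol hz
  have h := weighted_sum_le_of_linearization (L := 2 * c * r)
    (fun i => esymmOn_erase_pos hμ i k (Nat.lt_succ_self k)) hR hT hA
    (fun q => hlin (realBasis q)) hμx
    (fun i => lineLaplacian_sq_le isOpen_ball hu hz (hv _ (hv1 i)).2)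
    (fun i => (lineLaplacian_le_of_isLocalMax isOpen_ball hu hz hmax (v i)).trans (by
      nlinarith [mul_le_mul_of_nonneg_left (hv _ (hv1 i)).1 hc]))
    (fun i q => hαA q _ (hv _ (hv1 i)).2) (fun i q => hχA q _ (hv _ (hv1 i)).2)
    (fun i => hχ0 _ (hv _ (hv1 i)).2) hW hH
  refine le_trans ?_ h
  rw [show 2 * (2 * c * r) = 4 * c * r by ring]
  exact mul_le_mul_of_nonneg_left (le_sum_esymmOn_erase hkn hμ hb (hμf ▸ hbf)) (by linarith)

lemma quadForm_real_smul {n : ℕ} (M : Matrix (Fin n) (Fin n) ℂ) (t : ℝ) (v : Cn n) :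
    quadForm M (t • v) = t ^ 2 * quadForm M v := by
  unfold quadForm
  rw [← Complex.re_ofReal_mul, Finset.mul_sum]
  congr 1
  refine Finset.sum_congr rfl fun k _ => ?_
  rw [Finset.mul_sum]
  refine Finset.sum_congr rfl fun l _ => ?_
  simp only [PiLp.smul_apply, Complex.real_smul, map_mul, Complex.conj_ofReal, Complex.ofReal_pow]
  ring

lemma exists_abs_quadForm_le {n : ℕ} {M : Cn n → Matrix (Fin n) (Fin n) ℂ} {S : Set (Cn n)}
    (hS : IsCompact S) (hM : ∀ k l, ContinuousOn (fun z => M z k l) S) :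
    ∃ B : ℝ, 0 < B ∧ ∀ z ∈ S, ∀ v, |quadForm (M z) v| ≤ B * ‖v‖ ^ 2 := by
  have hc : ContinuousOn (fun z => ∑ k, ∑ l, ‖M z k l‖) S :=
    continuousOn_finsetSum _ fun k _ => continuousOn_finsetSum _ fun l _ => (hM k l).norm
  obtain ⟨B, hB⟩ := hS.exists_bound_of_continuousOn hc
  refine ⟨max B 1, by positivity, fun z hz v => (abs_quadForm_le _ _).trans ?_⟩
  gcongr
  exact ((le_abs_self _).trans (hB z hz)).trans (le_max_left _ _)

lemma exists_le_quadForm {n : ℕ} {M : Cn n → Matrix (Fin n) (Fin n) ℂ} {S : Set (Cn n)}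
    (hS : IsCompact S) (hM : ∀ k l, ContinuousOn (fun z => M z k l) S)
    (hpos : ∀ z ∈ S, (M z).PosDef) :
    ∃ b : ℝ, 0 < b ∧ ∀ z ∈ S, ∀ v, b * ‖v‖ ^ 2 ≤ quadForm (M z) v := by
  have hc : ContinuousOn (fun p : Cn n × Cn n => quadForm (M p.1) p.2)
      (S ×ˢ sphere (0 : Cn n) 1) := by
    unfold quadForm
    refine Complex.continuous_re.comp_continuousOn ?_
    refine continuousOn_finsetSum _ fun k _ => continuousOn_finsetSum _ fun l _ => ?_
    have h1 : ContinuousOn (fun p : Cn n × Cn n => M p.1 k l) (S ×ˢ sphere (0 : Cn n) 1) :=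
      (hM k l).comp continuousOn_fst fun p hp => hp.1
    exact ((by fun_prop : Continuous fun p : Cn n × Cn n => p.2 k).continuousOn.mul h1).mul
      (Complex.continuous_conj.comp (by fun_prop)).continuousOn
  obtain ⟨b, hb, hbM⟩ := (hS.prod (isCompact_sphere _ _)).exists_forall_le' hc (a := 0)
    fun p hp => (hpos _ hp.1).quadForm_pos (ne_zero_of_mem_unit_sphere ⟨p.2, hp.2⟩)
  refine ⟨b, hb, fun z hz v => ?_⟩
  rcases eq_or_ne v 0 with rfl | hv
  · simp [quadForm]
  · have hn : ‖v‖ ≠ 0 := norm_ne_zero_iff.2 hv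
    have h := hbM (z, ‖v‖⁻¹ • v) ⟨hz, by simp [norm_smul, hn]⟩
    rw [quadForm_real_smul, inv_pow, inv_mul_eq_div, le_div_iff₀ (by positivity)] at h
    exact h

/-- Uniform bounds on the half ball for the metric and the form, in frames normalised by the
metric. -/
lemma exists_frame_bounds {n : ℕ} {α χ : Cn n → Matrix (Fin n) (Fin n) ℂ}
    (hα : IsHermitianMetricOn α (closedBall 0 1)) (hχ : IsRealFormOn χ (closedBall 0 1)) :
    ∃ r R A : ℝ, 0 < r ∧ 0 < R ∧ 0 ≤ A ∧ ∀ z ∈ closedBall (0 : Cn n) (1 / 2),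
      (∀ v, quadForm (α z) v = 1 → r ≤ ‖v‖ ^ 2 ∧ ‖v‖ ^ 2 ≤ R) ∧
      (∀ q v, ‖v‖ ^ 2 ≤ R → |quadForm (matDeriv (realBasis q) α z) v| ≤ A) ∧
      (∀ q v, ‖v‖ ^ 2 ≤ R → |quadForm (matDeriv (realBasis q) χ z) v| ≤ A) ∧
      ∀ v, ‖v‖ ^ 2 ≤ R → |quadForm (χ z) v| ≤ A := by
  have hS : IsCompact (closedBall (0 : Cn n) (1 / 2)) := isCompact_closedBall _ _
  have hsub : closedBall (0 : Cn n) (1 / 2) ⊆ ball 0 1 := closedBall_subset_ball (by norm_num)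
  have hsub' := hsub.trans ball_subset_closedBall
  have hderiv : ∀ {M : Cn n → Matrix (Fin n) (Fin n) ℂ},
      (∀ k l, ContDiffOn ℝ ∞ (fun z => M z k l) (closedBall 0 1)) → ∃ B : Fin n × Bool → ℝ,
      ∀ q, 0 < B q ∧ ∀ z ∈ closedBall (0 : Cn n) (1 / 2), ∀ v,
        |quadForm (matDeriv (realBasis q) M z) v| ≤ B q * ‖v‖ ^ 2 := fun hM =>
    Classical.skolem.1 fun q => exists_abs_quadForm_le hS fun k l =>
      (((hM k l).mono ball_subset_closedBall).dirDeriv isOpen_ball _).continuousOn.mono hsub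
  have hcα := fun k l => (hα.1 k l).continuousOn.mono hsub'
  have hcχ := fun k l => (hχ.1 k l).continuousOn.mono hsub'
  obtain ⟨B, hB, hBα⟩ := exists_abs_quadForm_le hS hcα
  obtain ⟨b, hb, hbα⟩ := exists_le_quadForm hS hcα fun z hz => hα.2 z (hsub' hz)
  obtain ⟨E, hE, hEχ⟩ := exists_abs_quadForm_le hS hcχ
  obtain ⟨Bα, hBα'⟩ := hderiv hα.1
  obtain ⟨Bχ, hBχ'⟩ := hderiv hχ.1
  have hsα : ∀ q, Bα q ≤ ∑ q, Bα q := fun q =>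
    Finset.single_le_sum (fun q _ => (hBα' q).1.le) (Finset.mem_univ q)
  have hsχ : ∀ q, Bχ q ≤ ∑ q, Bχ q := fun q =>
    Finset.single_le_sum (fun q _ => (hBχ' q).1.le) (Finset.mem_univ q)
  have h0α : 0 ≤ ∑ q, Bα q := Finset.sum_nonneg fun q _ => (hBα' q).1.le
  have h0χ : 0 ≤ ∑ q, Bχ q := Finset.sum_nonneg fun q _ => (hBχ' q).1.le
  have hle : ∀ {v : Cn n} {C : ℝ}, ‖v‖ ^ 2 ≤ b⁻¹ → C ≤ ∑ q, Bα q + ∑ q, Bχ q + E →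
      C * ‖v‖ ^ 2 ≤ (∑ q, Bα q + ∑ q, Bχ q + E) * b⁻¹ := fun hv hC =>
    mul_le_mul hC hv (sq_nonneg _) (by positivity)
  refine ⟨B⁻¹, b⁻¹, (∑ q, Bα q + ∑ q, Bχ q + E) * b⁻¹, inv_pos.2 hB, inv_pos.2 hb,
    by positivity, fun z hz => ⟨fun v hv => ⟨?_, ?_⟩, fun q v hv => ?_, fun q v hv => ?_,
      fun v hv => ?_⟩⟩
  · rw [inv_le_iff_one_le_mul₀' hB]
    simpa [hv] using hBα z hz v
  · rw [← one_div, le_div_iff₀' hb, ← hv]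
    exact hbα z hz v
  · exact ((hBα' q).2 z hz v).trans (hle hv (by linarith [hsα q]))
  · exact ((hBχ' q).2 z hz v).trans (hle hv (by linarith [hsχ q]))
  · exact (hEχ z hz v).trans (hle hv (by linarith))

/-- The squared gradient of `u`, relative to the closed ball of radius `δ`. -/
def gradSq {n : ℕ} (δ : ℝ) (u : Cn n → ℝ) (z : Cn n) : ℝ :=
  ∑ q : Fin n × Bool, fderivWithin ℝ u (closedBall 0 δ) z (realBasis q) ^ 2

lemma gradSq_eq {n : ℕ} {δ : ℝ} (u : Cn n → ℝ) {z : Cn n} (hz : z ∈ ball (0 : Cn n) δ) :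
    gradSq δ u z = ∑ q, dirDeriv (realBasis q) u z ^ 2 := by
  simp only [gradSq, fderivWithin_closedBall hz, dirDeriv]

lemma continuousOn_fderivWithin_closedBall {n : ℕ} {δ : ℝ} (hδ : 0 < δ) {u : Cn n → ℝ}
    (hu : ContDiffOn ℝ ∞ u (closedBall 0 δ)) :
    ContinuousOn (fderivWithin ℝ u (closedBall 0 δ)) (closedBall 0 δ) := by
  refine hu.continuousOn_fderivWithin (uniqueDiffOn_convex (convex_closedBall _ _) ?_) (by simp)
  exact ⟨0, ball_subset_interior_closedBall (mem_ball_self hδ)⟩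

lemma gradSq_le {n k : ℕ} (hkn : k + 1 ≤ n)
    {α χ : Cn n → Matrix (Fin n) (Fin n) ℂ} {u f : Cn n → ℝ} {δ r R A H b M : ℝ}
    (hδ : 0 < δ) (hδ1 : δ ≤ 1) (hr : 0 < r) (hR : 0 < R) (hA : 0 ≤ A) (hb : 0 < b)
    (hδD : δ ^ 2 * (Fintype.card (Fin n × Bool) * (R * A ^ 2 + 8 * (A ^ 2 + A))) ≤ r)
    (hα : IsHermitianMetricOn α (ball 0 δ)) (hχ : IsRealFormOn χ (ball 0 δ))
    (hu : ContDiffOn ℝ ∞ u (closedBall 0 δ)) (hf : ContDiffOn ℝ ∞ f (ball 0 δ))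
    (hsol : IsAdmissibleSolutionOn (k + 1) α χ (closedBall 0 δ) u f (ball 0 δ))
    (hbound : ∀ z ∈ ball (0 : Cn n) δ,
      (∀ v, quadForm (α z) v = 1 → r ≤ ‖v‖ ^ 2 ∧ ‖v‖ ^ 2 ≤ R) ∧
      (∀ q v, ‖v‖ ^ 2 ≤ R → |quadForm (matDeriv (realBasis q) α z) v| ≤ A) ∧
      (∀ q v, ‖v‖ ^ 2 ≤ R → |quadForm (matDeriv (realBasis q) χ z) v| ≤ A) ∧
      ∀ v, ‖v‖ ^ 2 ≤ R → |quadForm (χ z) v| ≤ A)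
    (hH : ∀ z ∈ ball (0 : Cn n) δ, ∀ q, |dirDeriv (realBasis q) f z| ≤ H)
    (hbf : ∀ z ∈ ball (0 : Cn n) δ, b ^ (k + 1) ≤ f z)
    (hM : ∀ z ∈ sphere (0 : Cn n) δ, ‖fderivWithin ℝ u (closedBall 0 δ) z‖ ≤ M)
    {z : Cn n} (hz : z ∈ closedBall (0 : Cn n) δ) :
    gradSq δ u z ≤ max 1 (max (2 * (Fintype.card (Fin n × Bool) * M ^ 2))
      ((8 * Fintype.card (Fin n × Bool) * H / (r * b ^ k)) ^ 2)) := by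
  have hWc : ContinuousOn (gradSq δ u) (closedBall 0 δ) := continuousOn_finsetSum _ fun q _ =>
    ((continuousOn_fderivWithin_closedBall hδ hu).clm_apply continuousOn_const).pow 2
  have hne : (closedBall (0 : Cn n) δ).Nonempty := ⟨z, hz⟩
  have hcpt : IsCompact (closedBall (0 : Cn n) δ) := isCompact_closedBall _ _
  obtain ⟨z₁, hz₁, hmax₁⟩ := hcpt.exists_isMaxOn hne hWc
  set K := gradSq δ u z₁ with hK
  set N := (Fintype.card (Fin n × Bool) : ℝ) with hN
  set D := N * (R * A ^ 2 + 8 * (A ^ 2 + A)) with hD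
  refine (hmax₁ hz).trans ?_
  rcases le_or_gt K 1 with hK1 | hK1
  · exact hK1.trans (le_max_left _ _)
  refine le_max_of_le_right ?_
  have hc : 0 ≤ K / (2 * δ ^ 2) := by positivity
  obtain ⟨z₀, hz₀, hmax₀⟩ := hcpt.exists_isMaxOn hne
    (hWc.add (continuousOn_const.mul (continuous_norm.pow 2).continuousOn :
      ContinuousOn (fun y : Cn n => K / (2 * δ ^ 2) * ‖y‖ ^ 2) (closedBall 0 δ)))
  rcases (mem_closedBall.1 hz₀).lt_or_eq with hlt | heq
  · refine le_max_of_le_right ?_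
    have hT : Real.sqrt K ^ 2 = K := Real.sq_sqrt (by linarith)
    have hT1 : 1 ≤ Real.sqrt K := Real.one_le_sqrt.2 hK1.le
    have hlocal : IsLocalMax (fun y => ∑ q, dirDeriv (realBasis q) u y ^ 2
        + K / (2 * δ ^ 2) * ‖y‖ ^ 2) z₀ := by
      filter_upwards [isOpen_ball.mem_nhds (mem_ball.2 hlt)] with y hy
      rw [← gradSq_eq u hy, ← gradSq_eq u (mem_ball.2 hlt)]
      exact hmax₀ (ball_subset_closedBall hy)
    obtain ⟨hv, hαA, hχA, hχ0⟩ := hbound z₀ hlt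
    have hkr : K * D ≤ K * r / δ ^ 2 := by
      rw [le_div_iff₀ (by positivity)]
      nlinarith
    have hkr' : K * r ≤ K * r / δ ^ 2 := by
      rw [le_div_iff₀ (by positivity)]
      exact mul_le_of_le_one_right (by positivity) (pow_le_one₀ hδ.le hδ1)
    have hKr : 0 < K * r := mul_pos (by linarith) hr
    have hcr : 4 * (K / (2 * δ ^ 2)) * r = 2 * (K * r / δ ^ 2) := by
      field_simp
      norm_num
    have h := interior_max_estimate hkn hα hχ (hu.mono ball_subset_closedBall) hf hsol hlt hR hA
      hv hαA hχA hχ0 (hH z₀ hlt) hb.le (hbf z₀ hlt) hT1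
      (by rw [hT, ← gradSq_eq u (mem_ball.2 hlt)]; exact hmax₁ hz₀) hc hlocal
      (by rw [hT, hcr, ← hN, ← hD]; linarith)
    rw [hT, hcr, ← hN, ← hD] at h
    have hs : Real.sqrt K ≤ 8 * N * H / (r * b ^ k) := by
      rw [le_div_iff₀ (by positivity)]
      refine le_of_mul_le_mul_left ?_ (show 0 < Real.sqrt K by linarith)
      calc Real.sqrt K * (Real.sqrt K * (r * b ^ k))
          = K * r * b ^ k := by rw [← mul_assoc, ← sq, hT, mul_assoc]
        _ ≤ (2 * (K * r / δ ^ 2) - K * D) * b ^ k := by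
            gcongr
            linarith
        _ ≤ Real.sqrt K * (8 * N * H) := by linarith
    exact hT.ge.trans (pow_le_pow_left₀ (Real.sqrt_nonneg K) hs 2)
  · refine le_max_of_le_left ?_
    have h1 : gradSq δ u z₀ ≤ N * M ^ 2 := by
      refine (Finset.sum_le_card_nsmul _ _ (M ^ 2) fun q _ => ?_).trans (by simp [hN])
      rw [← sq_abs]
      gcongr
      refine (ContinuousLinearMap.le_opNorm
        (fderivWithin ℝ u (closedBall 0 δ) z₀) (realBasis q)).trans ?_
      rw [norm_realBasis, mul_one]
      exact hM z₀ heq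
    have h2 : K + K / (2 * δ ^ 2) * ‖z₁‖ ^ 2 ≤ gradSq δ u z₀ + K / (2 * δ ^ 2) * ‖z₀‖ ^ 2 :=
      hmax₀ hz₁
    rw [dist_zero_right] at heq
    have h3 : K / (2 * δ ^ 2) * ‖z₀‖ ^ 2 = K / 2 := by
      rw [heq]
      field_simp
    have h4 : 0 ≤ K / (2 * δ ^ 2) * ‖z₁‖ ^ 2 := by positivity
    linarith
/-- Interior gradient estimate for admissible solutions of
`S_m(λ(A(u))) = h^m` on a sufficiently small ball. -/
theorem stmt2 (n m : ℕ) (hn : 2 ≤ n) (hm : 1 ≤ m) (hmn : m ≤ n)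
    (α χ : Cn n → Matrix (Fin n) (Fin n) ℂ)
    (hα : IsHermitianMetricOn α (closedBall 0 1))
    (hχ : IsRealFormOn χ (closedBall 0 1)) :
    ∃ δ₀ : ℝ, 0 < δ₀ ∧
      ∀ δ : ℝ, 0 < δ → δ ≤ δ₀ →
        (∀ z ∈ closedBall (0 : Cn n) δ, (χ z - α z).PosSemidef) →
        ∀ h : Cn n → ℝ, ContDiffOn ℝ ∞ h (closedBall 0 δ) →
          (∀ z ∈ closedBall (0 : Cn n) δ, 0 < h z) →
          ∀ M₁ M₂ : ℝ, ∃ C : ℝ,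
            ∀ u : Cn n → ℝ, ContDiffOn ℝ ∞ u (closedBall 0 δ) →
              IsAdmissibleSolutionOn m α χ (closedBall 0 δ) u
                (fun z => h z ^ m) (ball 0 δ) →
              (∀ z ∈ sphere (0 : Cn n) δ, u z = 0) →
              (∀ z ∈ ball (0 : Cn n) δ, |u z| ≤ M₁) →
              (∀ z ∈ sphere (0 : Cn n) δ,
                ‖fderivWithin ℝ u (closedBall 0 δ) z‖ ≤ M₂) →
              ∀ z ∈ ball (0 : Cn n) δ, ‖fderiv ℝ u z‖ ≤ C := by
  obtain ⟨r, R, A, hr, hR, hA, hbound⟩ := exists_frame_bounds hα hχ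
  obtain ⟨k, rfl⟩ : ∃ k, m = k + 1 := ⟨m - 1, by omega⟩
  set D : ℝ := (Fintype.card (Fin n × Bool) : ℝ) * (R * A ^ 2 + 8 * (A ^ 2 + A)) with hD
  have hD0 : 0 ≤ D := by positivity
  refine ⟨min (1 / 2) (r / (D + 1)), by positivity, fun δ hδ hδ₀ _ h hh hpos M₁ M₂ => ?_⟩
  have hδ2 : δ ≤ 1 / 2 := hδ₀.trans (min_le_left _ _)
  have hδD : δ ^ 2 * D ≤ r := by
    have h1 : δ * (D + 1) ≤ r := (le_div_iff₀ (by positivity)).1 (hδ₀.trans (min_le_right _ _))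
    nlinarith
  have hsub : ball (0 : Cn n) δ ⊆ closedBall 0 1 :=
    ball_subset_closedBall.trans (closedBall_subset_closedBall (by linarith))
  have hcpt : IsCompact (closedBall (0 : Cn n) δ) := isCompact_closedBall _ _
  obtain ⟨b, hb, hbh⟩ := hcpt.exists_forall_le' hh.continuousOn (a := 0) hpos
  have hf : ContDiffOn ℝ ∞ (fun z => h z ^ (k + 1)) (closedBall 0 δ) := hh.pow _
  obtain ⟨H, hH⟩ := hcpt.exists_bound_of_continuousOn (continuousOn_fderivWithin_closedBall hδ hf)
  refine ⟨Real.sqrt (max 1 (max (2 * (Fintype.card (Fin n × Bool) * M₂ ^ 2))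
    ((8 * Fintype.card (Fin n × Bool) * H / (r * b ^ k)) ^ 2))), fun u hu hsol _ _ hM z hz => ?_⟩
  have h1 := norm_le_sqrt_sum_realBasis (fderivWithin ℝ u (closedBall 0 δ) z)
  rw [fderivWithin_closedBall hz] at h1
  refine h1.trans (Real.sqrt_le_sqrt ?_)
  have h2 := gradSq_le hmn hδ (by linarith) hr hR hA hb hδD
    ⟨fun i j => (hα.1 i j).mono hsub, fun z hz => hα.2 z (hsub hz)⟩
    ⟨fun i j => (hχ.1 i j).mono hsub, fun z hz => hχ.2 z (hsub hz)⟩ hu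
    (hf.mono ball_subset_closedBall) hsol
    (fun z hz => hbound z (closedBall_subset_closedBall hδ2 (ball_subset_closedBall hz)))
    (H := H) (fun z hz q => ?_) (fun z hz => ?_) hM (ball_subset_closedBall hz)
  · rwa [gradSq_eq u hz] at h2
  · have h3 := (hH z (ball_subset_closedBall hz))
    rw [fderivWithin_closedBall hz] at h3
    refine (ContinuousLinearMap.le_opNorm (fderiv ℝ (fun z => h z ^ (k + 1)) z)
      (realBasis q)).trans ?_
    rwa [norm_realBasis, mul_one]
  · have h3 := hbh z (ball_subset_closedBall hz)
    gcongr
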